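/- Suppose ρ₁ = ρ₂ = ρ. Then μ_{M,D} is a spectral measure if and only if ρ⁻¹ is an integer divisible by p and either c = 0 or c = t/s for some integers t, s with t ∈ pℤ and gcd(t, s) = 1 (i.e., c is a rational number whose numerator in lowest terms is divisible by p). -/

import Mathlib

open MeasureTheory Complex Matrix
open scoped ENNReal

noncomputable section

/-- The exponential function `e_λ(x) = e^{-2πi⟨λ,x⟩}` on `ℝ²`. -/
def expChar (lam x : Fin 2 → ℝ) : ℂ :=
  Complex.exp ((-2 * Real.pi * Complex.I) * ((lam 0 * x 0 + lam 1 * x 1 : ℝ) : ℂ))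

/-- The Fourier transform `μ̂(ξ) = ∫ e^{-2πi⟨ξ,x⟩} dμ(x)` of a measure on `ℝ²`. -/
def ftMeasure (μ : Measure (Fin 2 → ℝ)) (ξ : Fin 2 → ℝ) : ℂ :=
  ∫ x, expChar ξ x ∂μ

/-- The mask `m_D(ξ) = (1/p) Σ_{d∈D} e^{-2πi⟨ξ,d⟩}` of a digit system `D : Fin p → ℝ²`. -/
def mask {p : ℕ} (D : Fin p → (Fin 2 → ℝ)) (ξ : Fin 2 → ℝ) : ℂ :=
  (p : ℂ)⁻¹ * ∑ i : Fin p, expChar ξ (D i)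

/-- Integer digits, coerced to real vectors. -/
def digitR {p : ℕ} (D : Fin p → (Fin 2 → ℤ)) : Fin p → (Fin 2 → ℝ) :=
  fun i j => (D i j : ℝ)

/-- `μ` is the self-affine measure of the IFS `φ_d(x) = M⁻¹(x+d)`, `d ∈ D`:
a compactly supported Borel probability measure with `μ = (1/#D) Σ_d μ ∘ φ_d⁻¹`. -/
def IsSelfAffine {p : ℕ} (μ : Measure (Fin 2 → ℝ)) (M : Matrix (Fin 2) (Fin 2) ℝ)
    (D : Fin p → (Fin 2 → ℝ)) : Prop :=
  IsProbabilityMeasure μ ∧ (∃ K : Set (Fin 2 → ℝ), IsCompact K ∧ μ Kᶜ = 0) ∧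
  μ = (p : ℝ≥0∞)⁻¹ • ∑ i : Fin p, μ.map (fun x => M⁻¹.mulVec (x + D i))

/-- `Λ` is an orthogonal set of exponentials for `μ`. -/
def IsOrthoSet (μ : Measure (Fin 2 → ℝ)) (Λ : Set (Fin 2 → ℝ)) : Prop :=
  ∀ l ∈ Λ, ∀ l' ∈ Λ, l ≠ l' → ftMeasure μ (l - l') = 0

/-- `μ` is a spectral measure: some countable set of exponentials forms an
orthonormal (Hilbert) basis of `L²(μ)`. -/
def IsSpectral (μ : Measure (Fin 2 → ℝ)) : Prop :=
  ∃ Λ : Set (Fin 2 → ℝ), Λ.Countable ∧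
    ∃ b : HilbertBasis Λ ℂ (Lp ℂ 2 μ),
      ∀ lam : Λ, ⇑(b lam) =ᵐ[μ] expChar (lam : Fin 2 → ℝ)

/-- The standing assumption on the digit set: `a = (a₁,a₂)` has entries in `[1,p-1]`
and `Z(m_D) = ⋃_{j=1}^{p-1} (j·a/p + ℤ²)`. -/
def ZeroSetCond (p : ℕ) (D : Fin p → (Fin 2 → ℤ)) (a : Fin 2 → ℤ) : Prop :=
  (∀ i, 1 ≤ a i ∧ a i ≤ (p : ℤ) - 1) ∧
  ∀ ξ : Fin 2 → ℝ, mask (digitR D) ξ = 0 ↔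
    ∃ j : ℕ, 1 ≤ j ∧ j ≤ p - 1 ∧ ∃ k : Fin 2 → ℤ,
      ∀ i, ξ i = (j : ℝ) * (a i : ℝ) / p + (k i : ℝ)

/-- The upper-triangular expanding matrix `M = [[ρ₁⁻¹, c],[0, ρ₂⁻¹]]`. -/
def Mupper (ρ₁ ρ₂ c : ℝ) : Matrix (Fin 2) (Fin 2) ℝ := !![ρ₁⁻¹, c; 0, ρ₂⁻¹]

/-- The set `E_a = {h/l : gcd(h,l)=1, l·a₂ − h·a₁ ∈ ℤ∖pℤ} ∪ {0}`. -/
def Ea (p : ℕ) (a : Fin 2 → ℤ) : Set ℝ :=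
  {x | ∃ h l : ℤ, Int.gcd h l = 1 ∧ ¬ ((p : ℤ) ∣ (l * a 1 - h * a 0)) ∧
    x = (h : ℝ) / (l : ℝ)} ∪ {0}

abbrev V2 := Fin 2 → ℝ

lemma expChar_add_left (l l' x : V2) : expChar (l + l') x = expChar l x * expChar l' x := by
  unfold expChar
  rw [← Complex.exp_add]
  congr 1
  simp only [Pi.add_apply]
  push_cast
  ring

lemma expChar_add_right (l x x' : V2) : expChar l (x + x') = expChar l x * expChar l x' := by
  unfold expChar
  rw [← Complex.exp_add]
  congr 1
  simp only [Pi.add_apply]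
  push_cast
  ring

lemma expChar_zero_left (x : V2) : expChar 0 x = 1 := by simp [expChar]
lemma expChar_zero_right (x : V2) : expChar x 0 = 1 := by simp [expChar]

lemma norm_expChar (l x : V2) : ‖expChar l x‖ = 1 := by
  unfold expChar
  rw [Complex.norm_exp]
  simp

lemma conj_expChar (l x : V2) : (starRingEnd ℂ) (expChar l x) = expChar (-l) x := by
  unfold expChar
  rw [← Complex.exp_conj]
  congr 1
  simp only [map_mul, map_neg, Complex.conj_ofReal, Complex.conj_I, Pi.neg_apply, map_ofNat]
  push_cast
  ring

lemma expChar_neg_right (l x : V2) : expChar l (-x) = expChar (-l) x := by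
  unfold expChar
  congr 1
  simp only [Pi.neg_apply]
  push_cast
  ring

@[fun_prop]
lemma continuous_expChar (l : V2) : Continuous (expChar l) := by
  unfold expChar
  fun_prop

lemma continuous_expChar_left (x : V2) : Continuous (fun l => expChar l x) := by
  unfold expChar
  fun_prop

lemma expChar_eq_one_of_int (l x : V2) (n : ℤ) (h : l 0 * x 0 + l 1 * x 1 = n) :
    expChar l x = 1 := by
  unfold expChar
  rw [h, Complex.exp_eq_one_iff]
  exact ⟨-n, by push_cast; ring⟩

lemma memLp_expChar (ν : Measure V2) [IsFiniteMeasure ν] (l : V2) :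
    MemLp (expChar l) 2 ν :=
  MemLp.of_bound (continuous_expChar l).aestronglyMeasurable 1
    (Filter.Eventually.of_forall fun x => (norm_expChar l x).le)

lemma integrable_expChar (ν : Measure V2) [IsFiniteMeasure ν] (l : V2) :
    Integrable (expChar l) ν :=
  Integrable.of_bound (continuous_expChar l).aestronglyMeasurable 1
    (Filter.Eventually.of_forall fun x => (norm_expChar l x).le)

/-- exponentials as elements of `L²`. -/
def eL (ν : Measure V2) [IsFiniteMeasure ν] (l : V2) : Lp ℂ 2 ν := (memLp_expChar ν l).toLp _

lemma eL_coe (ν : Measure V2) [IsFiniteMeasure ν] (l : V2) : eL ν l =ᵐ[ν] expChar l :=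
  MemLp.coeFn_toLp _

lemma inner_eL (ν : Measure V2) [IsFiniteMeasure ν] (l l' : V2) :
    inner ℂ (eL ν l) (eL ν l') = ftMeasure ν (l' - l) := by
  rw [L2.inner_def]
  unfold ftMeasure
  apply integral_congr_ae
  filter_upwards [eL_coe ν l, eL_coe ν l'] with x h1 h2
  rw [h1, h2, sub_eq_add_neg, expChar_add_left, ← conj_expChar]
  simp [RCLike.inner_apply]

lemma ft_zero (ν : Measure V2) [IsProbabilityMeasure ν] : ftMeasure ν 0 = 1 := by
  simp [ftMeasure, expChar_zero_left]

lemma ft_neg (ν : Measure V2) (x : V2) : ftMeasure ν (-x) = (starRingEnd ℂ) (ftMeasure ν x) := by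
  unfold ftMeasure
  rw [← integral_conj]
  simp [conj_expChar]

lemma ft_norm_neg (ν : Measure V2) (x : V2) : ‖ftMeasure ν (-x)‖ = ‖ftMeasure ν x‖ := by
  rw [ft_neg, RCLike.norm_conj]

lemma ft_norm_le (ν : Measure V2) [IsProbabilityMeasure ν] (x : V2) : ‖ftMeasure ν x‖ ≤ 1 := by
  unfold ftMeasure
  refine (norm_integral_le_integral_norm _).trans ?_
  simp [norm_expChar]

lemma ft_continuous (ν : Measure V2) [IsProbabilityMeasure ν] : Continuous (ftMeasure ν) := by
  unfold ftMeasure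
  refine continuous_of_dominated (bound := fun _ => 1) ?_ ?_ (integrable_const _) ?_
  · intro l; exact (continuous_expChar l).aestronglyMeasurable
  · intro l; exact Filter.Eventually.of_forall fun x => (norm_expChar l x).le
  · exact Filter.Eventually.of_forall fun x => continuous_expChar_left x

lemma norm_eL (ν : Measure V2) [IsProbabilityMeasure ν] (l : V2) : ‖eL ν l‖ = 1 := by
  have := inner_self_eq_norm_sq (𝕜 := ℂ) (eL ν l)
  rw [inner_eL, sub_self, ft_zero] at this
  have h1 : ‖eL ν l‖ ^ 2 = 1 := by simpa using this.symm
  nlinarith [norm_nonneg (eL ν l)]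

/-- `G` is the Fourier transform of a probability measure. -/
def IsFT (G : V2 → ℂ) : Prop := ∃ ν : Measure V2, IsProbabilityMeasure ν ∧ G = ftMeasure ν

lemma IsFT.bessel {G : V2 → ℂ} (hG : IsFT G) {ι : Type*} (l : ι → V2)
    (s : Finset ι) (h : ∀ i ∈ s, ∀ j ∈ s, i ≠ j → G (l i - l j) = 0) (ξ : V2) :
    ∑ i ∈ s, ‖G (ξ + l i)‖ ^ 2 ≤ 1 := by
  obtain ⟨ν, hν, rfl⟩ := hG
  have ho : Orthonormal ℂ (fun i : s => eL ν (l i)) := by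
    refine ⟨fun i => norm_eL ν _, fun i j hij => ?_⟩
    change inner ℂ (eL ν (l i)) (eL ν (l j)) = 0
    rw [inner_eL]
    exact h _ j.2 _ i.2 (fun h => hij (Subtype.ext h.symm))
  have := ho.sum_inner_products_le (x := eL ν (-ξ)) (s := Finset.univ)
  rw [norm_eL, one_pow] at this
  refine le_trans (le_of_eq ?_) this
  rw [← Finset.sum_attach]
  refine Finset.sum_congr (by simp) fun i _ => ?_
  rw [inner_eL, ← ft_norm_neg]
  congr 3
  abel

lemma IsFT.mul {G G' : V2 → ℂ} (hG : IsFT G) (hG' : IsFT G') : IsFT (fun x => G x * G' x) := by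
  obtain ⟨ν, hν, rfl⟩ := hG
  obtain ⟨ν', hν', rfl⟩ := hG'
  refine ⟨(ν.prod ν').map (fun z => z.1 + z.2), ?_, ?_⟩
  · exact Measure.isProbabilityMeasure_map (by fun_prop)
  · funext x
    unfold ftMeasure
    rw [integral_map (by fun_prop) (continuous_expChar x).aestronglyMeasurable]
    simp_rw [expChar_add_right]
    rw [integral_prod_mul]

lemma IsFT.one : IsFT (fun _ => 1) :=
  ⟨Measure.dirac 0, inferInstance, by
    funext x
    unfold ftMeasure
    rw [integral_dirac, expChar_zero_right]⟩

lemma IsFT.prod {ι : Type*} (s : Finset ι) (G : ι → V2 → ℂ) (h : ∀ i ∈ s, IsFT (G i)) :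
    IsFT (fun x => ∏ i ∈ s, G i x) := by
  classical
  induction s using Finset.induction_on with
  | empty => simpa using IsFT.one
  | insert i s his ih =>
    simp_rw [Finset.prod_insert his]
    exact (h i (by simp)).mul (ih fun j hj => h j (by simp [hj]))

/-- spectral implies Parseval. -/
lemma spectral_parseval (μ : Measure V2) [IsProbabilityMeasure μ] (h : IsSpectral μ) :
    ∃ Λ : Set V2, Λ.Countable ∧
      (∀ i j : Λ, i ≠ j → ftMeasure μ ((i : V2) - j) = 0) ∧
      ∀ ξ, HasSum (fun i : Λ => ‖ftMeasure μ (ξ + i)‖ ^ 2) 1 := by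
  obtain ⟨Λ, hΛ, b, hb⟩ := h
  have hb' : ∀ i : Λ, b i = eL μ i := fun i => Lp.ext ((hb i).trans (eL_coe μ i).symm)
  refine ⟨Λ, hΛ, fun i j hij => ?_, fun ξ => ?_⟩
  · rw [← inner_eL, ← hb', ← hb']
    exact b.orthonormal.2 hij.symm
  · have := b.hasSum_inner_mul_inner (eL μ (-ξ)) (eL μ (-ξ))
    rw [inner_eL, sub_self, ft_zero] at this
    have h2 := Complex.hasSum_re this
    simp only [Complex.one_re] at h2
    convert! h2 using 2 with i
    rw [hb', inner_eL, inner_eL]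
    have e1 : (i : V2) - -ξ = ξ + i := by abel
    have e2 : -ξ - (i : V2) = -(ξ + i) := by abel
    rw [e1, e2, ft_neg, Complex.mul_conj, Complex.ofReal_re, Complex.normSq_eq_norm_sq]

lemma real_zero_of_ft (μ : Measure V2) [IsProbabilityMeasure μ] (h : V2 → ℝ)
    (hi : Integrable h μ) (h0 : ∀ l, ∫ x, expChar l x * (h x : ℂ) ∂μ = 0) : h =ᵐ[μ] 0 := by
  have hm := hi.aestronglyMeasurable.aemeasurable
  have hn : Integrable (fun x => -h x) μ := hi.neg
  have fin1 : IsFiniteMeasure (μ.withDensity fun x => ENNReal.ofReal (h x)) :=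
    isFiniteMeasure_withDensity_ofReal hi.2
  have fin2 : IsFiniteMeasure (μ.withDensity fun x => ENNReal.ofReal (-h x)) :=
    isFiniteMeasure_withDensity_ofReal hn.2
  have key : (μ.withDensity fun x => ENNReal.ofReal (h x)) =
      (μ.withDensity fun x => ENNReal.ofReal (-h x)) := by
    apply Measure.ext_of_charFunDual
    funext L
    rw [charFunDual_apply, charFunDual_apply]
    let l : V2 := ![-(L (Pi.single 0 1)) / (2 * Real.pi), -(L (Pi.single 1 1)) / (2 * Real.pi)]
    have hL : ∀ x : V2, Complex.exp (L x * Complex.I) = expChar l x := by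
      intro x
      have hx : x = x 0 • Pi.single 0 1 + x 1 • Pi.single 1 1 := by
        ext i; fin_cases i <;> simp
      have hLx : L x = x 0 * L (Pi.single 0 1) + x 1 * L (Pi.single 1 1) := by
        conv_lhs => rw [hx]
        simp
      unfold expChar
      congr 1
      rw [hLx]
      simp only [l]
      have := Real.pi_ne_zero
      have hpi : (Real.pi : ℂ) ≠ 0 := by exact_mod_cast this
      simp
      field_simp
      ring
    simp_rw [hL]
    have conv : ∀ g : V2 → ℝ, Integrable g μ →
        ∫ x, expChar l x ∂(μ.withDensity fun x => ENNReal.ofReal (g x)) =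
          ∫ x, expChar l x * ((max (g x) 0 : ℝ) : ℂ) ∂μ := by
      intro g hg
      have hgm := hg.aestronglyMeasurable.aemeasurable
      have : (fun x => ENNReal.ofReal (g x)) = fun x => ((Real.toNNReal (g x) : NNReal) : ℝ≥0∞) := rfl
      rw [this, integral_withDensity_eq_integral_smul₀ hgm.real_toNNReal]
      congr 1
      funext x
      rw [NNReal.smul_def, Complex.real_smul, mul_comm, Real.coe_toNNReal']
    rw [conv h hi, conv _ hn, ← sub_eq_zero, ← integral_sub]
    · rw [← h0 l]
      congr 1
      funext x
      rw [← mul_sub, ← Complex.ofReal_sub]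
      congr 2
      rcases le_total (h x) 0 with hx | hx
      · rw [max_eq_right hx, max_eq_left (by linarith)]; ring
      · rw [max_eq_left hx, max_eq_right (by linarith)]; ring
    · refine Integrable.bdd_mul (c := 1) (hi.pos_part.ofReal) (continuous_expChar l).aestronglyMeasurable
        (Filter.Eventually.of_forall fun x => (norm_expChar l x).le)
    · refine Integrable.bdd_mul (c := 1) (hn.pos_part.ofReal) (continuous_expChar l).aestronglyMeasurable
        (Filter.Eventually.of_forall fun x => (norm_expChar l x).le)
  rw [withDensity_eq_iff (by fun_prop) (by fun_prop)] at key
  · filter_upwards [key] with x hx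
    rcases le_total (h x) 0 with h1 | h1
    · rw [ENNReal.ofReal_of_nonpos h1, eq_comm, ENNReal.ofReal_eq_zero] at hx
      simp only [Pi.zero_apply]; linarith
    · rw [ENNReal.ofReal_of_nonpos (by linarith : -h x ≤ 0), ENNReal.ofReal_eq_zero] at hx
      simp only [Pi.zero_apply]; linarith
  · have := fin1.measure_univ_lt_top
    rw [withDensity_apply _ MeasurableSet.univ] at this
    simpa using this.ne

/-- exponentials are total in `L²`. -/
lemma eL_total (μ : Measure V2) [IsProbabilityMeasure μ] (f : Lp ℂ 2 μ)
    (h : ∀ l, inner ℂ (eL μ l) f = 0) : f = 0 := by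
  have hfi : Integrable f μ := (Lp.memLp f).integrable (by norm_num)
  have h1 : ∀ l, ∫ x, expChar l x * f x ∂μ = 0 := by
    intro l
    rw [← h (-l), L2.inner_def]
    apply integral_congr_ae
    filter_upwards [eL_coe μ (-l)] with x hx
    rw [hx, RCLike.inner_apply, conj_expChar, neg_neg, mul_comm]
  have h2 : ∀ l, ∫ x, expChar l x * (starRingEnd ℂ) (f x) ∂μ = 0 := by
    intro l
    have := congrArg (starRingEnd ℂ) (h1 (-l))
    rw [← integral_conj, map_zero] at this
    simpa [conj_expChar] using this
  have hfc : Integrable (fun x => (starRingEnd ℂ) (f x)) μ := by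
    refine hfi.mono ?_ (Filter.Eventually.of_forall fun x => by simp)
    exact Complex.continuous_conj.comp_aestronglyMeasurable hfi.aestronglyMeasurable
  have i1 : ∀ l, Integrable (fun x => expChar l x * f x) μ := fun l =>
    Integrable.bdd_mul (c := 1) hfi (continuous_expChar l).aestronglyMeasurable
        (Filter.Eventually.of_forall fun x => (norm_expChar l x).le)
  have i2 : ∀ l, Integrable (fun x => expChar l x * (starRingEnd ℂ) (f x)) μ := fun l =>
    Integrable.bdd_mul (c := 1) hfc (continuous_expChar l).aestronglyMeasurable
        (Filter.Eventually.of_forall fun x => (norm_expChar l x).le)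
  have r1 := real_zero_of_ft μ (fun x => (f x).re) hfi.re (by
    intro l
    have : ∀ x, expChar l x * ((f x).re : ℂ) =
        (1 / 2 : ℂ) * (expChar l x * f x + expChar l x * (starRingEnd ℂ) (f x)) := by
      intro x
      rw [Complex.re_eq_add_conj]; ring
    simp_rw [this]
    rw [integral_const_mul, integral_add (i1 l) (i2 l), h1, h2]; simp)
  have r2 := real_zero_of_ft μ (fun x => (f x).im) hfi.im (by
    intro l
    have : ∀ x, expChar l x * ((f x).im : ℂ) =
        (1 / (2 * Complex.I) : ℂ) * (expChar l x * f x - expChar l x * (starRingEnd ℂ) (f x)) := by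
      intro x
      rw [Complex.im_eq_sub_conj]; ring
    simp_rw [this]
    rw [integral_const_mul, integral_sub (i1 l) (i2 l), h1, h2]; simp)
  rw [Lp.eq_zero_iff_ae_eq_zero]
  filter_upwards [r1, r2] with x a b
  exact Complex.ext a b

/-- Parseval implies spectral. -/
lemma parseval_spectral (μ : Measure V2) [IsProbabilityMeasure μ] (l : ℕ → V2)
    (h : ∀ ξ, HasSum (fun i => ‖ftMeasure μ (ξ + l i)‖ ^ 2) 1) : IsSpectral μ := by
  have orth : ∀ i j, i ≠ j → ftMeasure μ (l i - l j) = 0 := by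
    intro i j hij
    have hs := h (-l j)
    have h1 := sum_le_hasSum {i, j} (fun k _ => by positivity) hs
    rw [Finset.sum_pair hij] at h1
    have e : -l j + l j = 0 := by abel
    rw [e, ft_zero] at h1
    have e2 : -l j + l i = l i - l j := by abel
    rw [e2] at h1
    simpa using h1
  have inj : Function.Injective l := by
    intro i j hij
    by_contra hne
    have := orth i j hne
    rw [hij, sub_self, ft_zero] at this
    exact one_ne_zero this
  have hex : ∀ x : Set.range l, ∃ i, l i = x := fun x => x.2
  have ho : Orthonormal ℂ (fun x : Set.range l => eL μ x) := by
    refine ⟨fun i => norm_eL μ _, fun x y hxy => ?_⟩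
    obtain ⟨i, hi⟩ := hex x
    obtain ⟨j, hj⟩ := hex y
    change inner ℂ (eL μ x) (eL μ y) = 0
    rw [inner_eL, ← hi, ← hj]
    refine orth _ _ fun hh => hxy (Subtype.ext ?_)
    rw [← hi, ← hj, hh]
  have hbot : (Submodule.span ℂ (Set.range (fun x : Set.range l => eL μ x)))ᗮ = ⊥ := by
    rw [Submodule.eq_bot_iff]
    intro f hf
    rw [Submodule.mem_orthogonal] at hf
    have hf' : ∀ i, inner ℂ (eL μ (l i)) f = 0 := fun i =>
      hf _ (Submodule.subset_span ⟨⟨l i, i, rfl⟩, rfl⟩)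
    apply eL_total
    intro ξ
    -- extend the orthonormal family by the normalised f
    by_contra hne
    have hf0 : f ≠ 0 := by rintro rfl; simp at hne
    let v : Option ℕ → Lp ℂ 2 μ := fun o => o.elim ((‖f‖⁻¹ : ℂ) • f) (fun i => eL μ (l i))
    have hv : Orthonormal ℂ v := by
      refine ⟨?_, ?_⟩
      · rintro (_ | i)
        · simp only [v, Option.elim]
          rw [norm_smul]
          simp [hf0]
        · exact norm_eL μ _
      · rintro (_ | i) (_ | j) hij
        · exact absurd rfl hij
        · change inner ℂ ((‖f‖⁻¹ : ℂ) • f) (eL μ (l j)) = 0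
          rw [inner_smul_left, ← inner_conj_symm, hf']; simp
        · change inner ℂ (eL μ (l i)) ((‖f‖⁻¹ : ℂ) • f) = 0
          rw [inner_smul_right, hf']; simp
        · change inner ℂ (eL μ (l i)) (eL μ (l j)) = 0
          rw [inner_eL]
          exact orth _ _ fun hh => hij (by rw [hh])
    have hb : ∀ s : Finset ℕ, ‖inner ℂ (v none) (eL μ ξ)‖ ^ 2 +
        ∑ i ∈ s, ‖ftMeasure μ (-ξ + l i)‖ ^ 2 ≤ 1 := by
      intro s
      have := hv.sum_inner_products_le (x := eL μ ξ) (s := Finset.insertNone s)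
      rw [Finset.sum_insertNone, norm_eL, one_pow] at this
      refine le_trans (le_of_eq ?_) this
      congr 1
      refine Finset.sum_congr rfl fun i _ => ?_
      change _ = ‖inner ℂ (eL μ (l i)) (eL μ ξ)‖ ^ 2
      rw [inner_eL, ← ft_norm_neg]
      congr 3
      abel
    have hlim := le_of_tendsto' ((h (-ξ)).const_add (‖inner ℂ (v none) (eL μ ξ)‖ ^ 2)) hb
    have hz : ‖inner ℂ (v none) (eL μ ξ)‖ ^ 2 = 0 := le_antisymm (by linarith) (by positivity)
    have hz' : inner ℂ (v none) (eL μ ξ) = 0 := by simpa using hz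
    change inner ℂ ((‖f‖⁻¹ : ℂ) • f) (eL μ ξ) = 0 at hz'
    rw [inner_smul_left] at hz'
    rcases mul_eq_zero.1 hz' with h3 | h3
    · simp at h3; exact hf0 h3
    · apply hne
      rw [← inner_conj_symm, h3]; simp
  refine ⟨Set.range l, Set.countable_range l, HilbertBasis.mkOfOrthogonalEqBot ho hbot, fun x => ?_⟩
  rw [HilbertBasis.coe_mkOfOrthogonalEqBot]
  exact eL_coe μ x

/-- the inverse transpose of the matrix. -/
def Tm (b c : ℝ) : V2 →ₗ[ℝ] V2 where
  toFun v := ![b⁻¹ * v 0, b⁻¹ * v 1 - c * b⁻¹ ^ 2 * v 0]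
  map_add' x y := by ext i; fin_cases i <;> simp <;> ring
  map_smul' r x := by ext i; fin_cases i <;> simp <;> ring

/-- the transpose of the matrix. -/
def Um (b c : ℝ) : V2 →ₗ[ℝ] V2 where
  toFun v := ![b * v 0, c * v 0 + b * v 1]
  map_add' x y := by ext i; fin_cases i <;> simp <;> ring
  map_smul' r x := by ext i; fin_cases i <;> simp <;> ring

lemma Tm_zero' (b c : ℝ) (v : V2) : Tm b c v 0 = b⁻¹ * v 0 := rfl
lemma Tm_one' (b c : ℝ) (v : V2) : Tm b c v 1 = b⁻¹ * v 1 - c * b⁻¹ ^ 2 * v 0 := rfl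
lemma Um_zero' (b c : ℝ) (v : V2) : Um b c v 0 = b * v 0 := rfl
lemma Um_one' (b c : ℝ) (v : V2) : Um b c v 1 = c * v 0 + b * v 1 := rfl

lemma Tm_Um {b c : ℝ} (hb : b ≠ 0) (v : V2) : Tm b c (Um b c v) = v := by
  ext i
  fin_cases i
  · change b⁻¹ * (b * v 0) = v 0
    field_simp
  · change b⁻¹ * (c * v 0 + b * v 1) - c * b⁻¹ ^ 2 * (b * v 0) = v 1
    field_simp
    ring

lemma Um_Tm {b c : ℝ} (hb : b ≠ 0) (v : V2) : Um b c (Tm b c v) = v := by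
  ext i
  fin_cases i
  · change b * (b⁻¹ * v 0) = v 0
    field_simp
  · change c * (b⁻¹ * v 0) + b * (b⁻¹ * v 1 - c * b⁻¹ ^ 2 * v 0) = v 1
    field_simp
    ring

lemma Tm_Um_pow {b c : ℝ} (hb : b ≠ 0) (k : ℕ) (v : V2) :
    (Tm b c ^ k) ((Um b c ^ k) v) = v := by
  induction k generalizing v with
  | zero => simp
  | succ k ih =>
    rw [pow_succ, pow_succ', Module.End.mul_apply, Module.End.mul_apply, Tm_Um hb, ih]

lemma Um_Tm_pow {b c : ℝ} (hb : b ≠ 0) (k : ℕ) (v : V2) :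
    (Um b c ^ k) ((Tm b c ^ k) v) = v := by
  induction k generalizing v with
  | zero => simp
  | succ k ih =>
    rw [pow_succ, pow_succ', Module.End.mul_apply, Module.End.mul_apply, Um_Tm hb, ih]

lemma Tm_pow_zero' (b c : ℝ) (k : ℕ) (v : V2) : (Tm b c ^ k) v 0 = (b⁻¹) ^ k * v 0 := by
  induction k with
  | zero => simp
  | succ k ih => rw [pow_succ', Module.End.mul_apply, Tm_zero', ih]; ring

lemma Um_pow_zero' (b c : ℝ) (k : ℕ) (v : V2) : (Um b c ^ k) v 0 = b ^ k * v 0 := by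
  induction k with
  | zero => simp
  | succ k ih => rw [pow_succ', Module.End.mul_apply, Um_zero', ih]; ring

lemma IsFT.comp {G : V2 → ℂ} (hG : IsFT G) (L : V2 →ₗ[ℝ] V2) : IsFT (fun x => G (L x)) := by
  obtain ⟨ν, hν, rfl⟩ := hG
  let e0 : V2 := Pi.single 0 1
  let e1 : V2 := Pi.single 1 1
  let A : V2 → V2 := fun y => ![L e0 0 * y 0 + L e0 1 * y 1, L e1 0 * y 0 + L e1 1 * y 1]
  have hA : Continuous A := by
    apply continuous_pi
    intro i
    fin_cases i <;> simp [A] <;> fun_prop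
  refine ⟨ν.map A, Measure.isProbabilityMeasure_map hA.aemeasurable, ?_⟩
  funext x
  unfold ftMeasure
  rw [integral_map hA.aemeasurable (continuous_expChar x).aestronglyMeasurable]
  congr 1
  funext y
  have hx : x = x 0 • e0 + x 1 • e1 := by
    ext i; fin_cases i <;> simp [e0, e1]
  have hLx : L x = x 0 • L e0 + x 1 • L e1 := by
    conv_lhs => rw [hx]
    simp
  unfold expChar
  congr 3
  rw [hLx]
  simp [A]
  ring

/-- integer vectors in the plane -/
def intV (k : Fin 2 → ℤ) : V2 := fun i => (k i : ℝ)

/-- the vector `j a / p` -/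
def jv (p : ℕ) (a : Fin 2 → ℤ) (j : ℕ) : V2 := fun i => (j : ℝ) * (a i : ℝ) / p

lemma intV_add (k k' : Fin 2 → ℤ) : intV (k + k') = intV k + intV k' := by
  ext i; simp [intV]
lemma intV_neg (k : Fin 2 → ℤ) : intV (-k) = -intV k := by
  ext i; simp [intV]
lemma intV_sub (k k' : Fin 2 → ℤ) : intV (k - k') = intV k - intV k' := by
  ext i; simp [intV]

/-- All that is used about the measure and the mask. -/
structure Sys (p : ℕ) (b c : ℝ) (a : Fin 2 → ℤ) (m F : V2 → ℂ) : Prop where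
  hp : p.Prime
  hb : 1 < b
  ha : ∀ i, ¬ (p : ℤ) ∣ a i
  per : ∀ x k, m (x + intV k) = m x
  zero : ∀ x, m x = 0 ↔ ∃ j : ℕ, 1 ≤ j ∧ j ≤ p - 1 ∧ ∃ k, x = jv p a j + intV k
  had : ∀ η, ∑ j : Fin p, ‖m (η + jv p a j)‖ ^ 2 = 1
  mle : ∀ x, ‖m x‖ ≤ 1
  mFT : IsFT m
  FFT : IsFT F
  Fcont : Continuous F
  F0 : F 0 = 1
  Fle : ∀ x, ‖F x‖ ≤ 1
  Frec : ∀ x, F x = m (Tm b c x) * F (Tm b c x)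
  gen : ∃ q : ℤ, q ≠ 0 ∧ (∀ x, ‖m x‖ < 1 ∨ ∃ N : ℤ, q * x 0 = N) ∧
    ∀ δ > 0, ∃ η, 0 ≤ η ∧ η < 1 ∧ ∀ x, ‖m x‖ ≤ η ∨ ∃ N : ℤ, |q * x 0 - N| < δ

lemma mask_isFT {p : ℕ} (hp : 0 < p) (D : Fin p → V2) : IsFT (mask D) := by
  have hp' : (p : ℝ≥0∞) ≠ 0 := by exact_mod_cast hp.ne'
  refine ⟨(p : ℝ≥0∞)⁻¹ • ∑ i : Fin p, Measure.dirac (D i), ⟨?_⟩, ?_⟩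
  · simp only [Measure.smul_apply, Measure.coe_finset_sum, Finset.sum_apply, measure_univ]
    simp only [Finset.sum_const, Finset.card_univ, Fintype.card_fin, nsmul_eq_mul, smul_eq_mul,
      mul_one]
    exact ENNReal.inv_mul_cancel hp' (ENNReal.natCast_ne_top p)
  · funext x
    unfold ftMeasure mask
    rw [integral_smul_measure, integral_finset_sum_measure]
    · simp [integral_dirac]
    · intro i _
      exact integrable_expChar _ _

lemma Mupper_inv {ρ c : ℝ} (hρ : ρ ≠ 0) :
    (Mupper ρ ρ c)⁻¹ = !![ρ, -(c * ρ ^ 2); 0, ρ] := by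
  apply Matrix.inv_eq_right_inv
  unfold Mupper
  rw [Matrix.mul_fin_two, Matrix.one_fin_two]
  ext i j
  fin_cases i <;> fin_cases j <;> simp <;> field_simp
  ring

lemma ft_rec {p : ℕ} {ρ c : ℝ} (hρ : ρ ≠ 0) (D : Fin p → V2) (μ : Measure V2)
    (hμ : IsSelfAffine μ (Mupper ρ ρ c) D) (x : V2) :
    ftMeasure μ x = mask D (Tm ρ⁻¹ c x) * ftMeasure μ (Tm ρ⁻¹ c x) := by
  obtain ⟨hpr, -, hinv⟩ := hμ
  have hc : ∀ i, Continuous (fun x : V2 => (Mupper ρ ρ c)⁻¹.mulVec (x + D i)) := by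
    intro i
    exact Continuous.matrix_mulVec continuous_const (by fun_prop)
  have key : ∀ i y, expChar x ((Mupper ρ ρ c)⁻¹.mulVec (y + D i)) =
      expChar (Tm ρ⁻¹ c x) (D i) * expChar (Tm ρ⁻¹ c x) y := by
    intro i y
    rw [mul_comm, ← expChar_add_right, Mupper_inv hρ]
    unfold expChar
    congr 3
    rw [Tm_zero', Tm_one']
    simp [Matrix.mulVec, dotProduct, Fin.sum_univ_two]
    ring
  conv_lhs => unfold ftMeasure; rw [hinv]
  rw [integral_smul_measure, integral_finset_sum_measure]
  · simp_rw [integral_map (hc _).aemeasurable (continuous_expChar x).aestronglyMeasurable, key,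
      integral_const_mul]
    rw [← Finset.sum_mul]
    unfold mask ftMeasure
    simp [mul_assoc]
  · intro i _
    have := Measure.isProbabilityMeasure_map (μ := μ) (hc i).aemeasurable
    exact integrable_expChar _ _

lemma mask_per {p : ℕ} (D : Fin p → (Fin 2 → ℤ)) (x : V2) (k : Fin 2 → ℤ) :
    mask (digitR D) (x + intV k) = mask (digitR D) x := by
  unfold mask
  congr 1
  refine Finset.sum_congr rfl fun i _ => ?_
  rw [expChar_add_left, expChar_eq_one_of_int (intV k) _ (k 0 * D i 0 + k 1 * D i 1), mul_one]
  simp [intV, digitR]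

lemma mask_le {p : ℕ} (hp : 0 < p) (D : Fin p → V2) (x : V2) : ‖mask D x‖ ≤ 1 := by
  obtain ⟨ν, hν, h⟩ := mask_isFT hp D
  rw [h]
  exact ft_norm_le ν x

lemma mask_continuous {p : ℕ} (hp : 0 < p) (D : Fin p → V2) : Continuous (mask D) := by
  obtain ⟨ν, hν, h⟩ := mask_isFT hp D
  rw [h]
  exact ft_continuous ν

lemma mask_had {p : ℕ} (hp : 0 < p) (D : Fin p → V2) (y : Fin p → V2)
    (h : ∀ j j', j ≠ j' → mask D (y j - y j') = 0) (η : V2) :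
    ∑ j : Fin p, ‖mask D (η + y j)‖ ^ 2 = 1 := by
  have hpc : (p : ℂ) ≠ 0 := by exact_mod_cast hp.ne'
  let A : Matrix (Fin p) (Fin p) ℂ := Matrix.of fun j i => expChar (y j) (D i)
  have hA : A * ((p : ℂ)⁻¹ • Aᴴ) = 1 := by
    ext j j'
    rw [Matrix.mul_smul, Matrix.smul_apply, Matrix.mul_apply, Matrix.one_apply]
    have : ∀ i, A j i * Aᴴ i j' = expChar (y j - y j') (D i) := by
      intro i
      rw [sub_eq_add_neg, expChar_add_left, ← conj_expChar]
      rfl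
    simp_rw [this]
    split_ifs with hjj
    · subst hjj
      simp [expChar_zero_left, hpc]
    · exact h j j' hjj
  have hA2 : ((p : ℂ)⁻¹ • Aᴴ) * A = 1 := mul_eq_one_comm.1 hA
  let v : Fin p → ℂ := fun i => expChar η (D i)
  have h1 : ∀ j, mask D (η + y j) = (p : ℂ)⁻¹ * (A *ᵥ v) j := by
    intro j
    unfold mask
    congr 1
    refine Finset.sum_congr rfl fun i _ => ?_
    rw [expChar_add_left, mul_comm]
    rfl
  have h2 : star (A *ᵥ v) ⬝ᵥ (A *ᵥ v) = (p : ℂ) * (star v ⬝ᵥ v) := by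
    have e : Aᴴ * A = (p : ℂ) • (1 : Matrix (Fin p) (Fin p) ℂ) := by
      rw [← hA2, Matrix.smul_mul, smul_smul, mul_inv_cancel₀ hpc, one_smul]
    rw [Matrix.star_mulVec, Matrix.dotProduct_mulVec, Matrix.vecMul_vecMul, e]
    rw [Matrix.vecMul_smul, Matrix.vecMul_one, smul_dotProduct, smul_eq_mul]
  have h3 : ∀ w : Fin p → ℂ, star w ⬝ᵥ w = ((∑ i, ‖w i‖ ^ 2 : ℝ) : ℂ) := by
    intro w
    simp only [dotProduct, Pi.star_apply, Complex.ofReal_sum]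
    refine Finset.sum_congr rfl fun i _ => ?_
    rw [mul_comm]
    have := Complex.mul_conj (w i)
    rw [Complex.normSq_eq_norm_sq] at this
    exact this
  rw [h3, h3] at h2
  have h4 : ∑ j, ‖(A *ᵥ v) j‖ ^ 2 = (p : ℝ) * p := by
    have : ∑ i, ‖v i‖ ^ 2 = (p : ℝ) := by simp [v, norm_expChar]
    rw [this] at h2
    exact_mod_cast h2
  have hpr : (p : ℝ) ≠ 0 := by exact_mod_cast hp.ne'
  simp_rw [h1, norm_mul, mul_pow]
  rw [← Finset.mul_sum, h4]
  simp
  field_simp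

lemma expChar_int_of_eq (x y z : V2) (h : expChar x y = expChar x z) :
    ∃ N : ℤ, x 0 * (y 0 - z 0) + x 1 * (y 1 - z 1) = N := by
  unfold expChar at h
  rw [Complex.exp_eq_exp_iff_exists_int] at h
  obtain ⟨n, hn⟩ := h
  refine ⟨-n, ?_⟩
  have hpi : (2 * Real.pi * Complex.I : ℂ) ≠ 0 := Complex.two_pi_I_ne_zero
  have : ((x 0 * (y 0 - z 0) + x 1 * (y 1 - z 1) : ℝ) : ℂ) = ((-n : ℤ) : ℂ) := by
    apply mul_left_cancel₀ hpi
    push_cast at hn ⊢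
    linear_combination -hn
  exact_mod_cast this

lemma mask_norm_one_eq {p : ℕ} (hp : 0 < p) (D : Fin p → V2) (x : V2) (h : 1 ≤ ‖mask D x‖)
    (i j : Fin p) : expChar x (D i) = expChar x (D j) := by
  by_cases hij : i = j
  · rw [hij]
  have hpr : (0 : ℝ) < p := by exact_mod_cast hp
  have h1 : (p : ℝ) ≤ ‖∑ k : Fin p, expChar x (D k)‖ := by
    unfold mask at h
    rw [norm_mul, norm_inv, Complex.norm_natCast] at h
    have := mul_le_mul_of_nonneg_left h hpr.le
    rwa [mul_one, ← mul_assoc, mul_inv_cancel₀ hpr.ne', one_mul] at this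
  have hmem : j ∈ (Finset.univ.erase i : Finset (Fin p)) := by simp [Ne.symm hij]
  rw [← Finset.add_sum_erase _ _ (Finset.mem_univ i), ← Finset.add_sum_erase _ _ hmem,
    ← add_assoc] at h1
  have h2 := norm_add_le (expChar x (D i) + expChar x (D j))
    (∑ k ∈ (Finset.univ.erase i).erase j, expChar x (D k))
  have h3 : ‖∑ k ∈ ((Finset.univ : Finset (Fin p)).erase i).erase j, expChar x (D k)‖
      ≤ (p : ℝ) - 2 := by
    refine (norm_sum_le _ _).trans ?_
    simp_rw [norm_expChar]
    rw [Finset.sum_const, Finset.card_erase_of_mem hmem, Finset.card_erase_of_mem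
      (Finset.mem_univ i), Finset.card_univ, Fintype.card_fin]
    have : 2 ≤ p := by
      by_contra hlt
      have : p = 1 := by omega
      subst this
      exact hij (Subsingleton.elim _ _)
    rw [nsmul_eq_mul, mul_one, Nat.sub_sub, Nat.cast_sub this]
    norm_num
  have h4 : 2 ≤ ‖expChar x (D i) + expChar x (D j)‖ := by linarith
  have h5 := parallelogram_law_with_norm ℝ (expChar x (D i)) (expChar x (D j))
  rw [norm_expChar, norm_expChar] at h5
  have h6 : ‖expChar x (D i) - expChar x (D j)‖ = 0 := by
    have := norm_nonneg (expChar x (D i) - expChar x (D j))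
    nlinarith
  exact sub_eq_zero.1 (norm_eq_zero.1 h6)

lemma exists_det {p : ℕ} (hp : p.Prime) (D : Fin p → (Fin 2 → ℤ)) (hD : Function.Injective D)
    (a : Fin 2 → ℤ) (hZ : ZeroSetCond p D a) :
    ∃ i j k : Fin p, (D i 0 - D k 0) * (D j 1 - D k 1) - (D i 1 - D k 1) * (D j 0 - D k 0) ≠ 0 := by
  by_contra hcon
  push Not at hcon
  have hp2 := hp.two_le
  have hpr : (0 : ℝ) < p := by exact_mod_cast hp.pos
  let i0 : Fin p := ⟨0, by omega⟩
  let i1 : Fin p := ⟨1, by omega⟩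
  have hne : D i1 ≠ D i0 := fun h => by
    have := hD h
    simp [i0, i1] at this
  let u : V2 := ![-((D i1 1 - D i0 1 : ℤ) : ℝ), ((D i1 0 - D i0 0 : ℤ) : ℝ)]
  obtain ⟨e, he⟩ : ∃ e, u e ≠ 0 := by
    by_contra hall
    push Not at hall
    apply hne
    have h0 := hall 0
    have h1 := hall 1
    simp only [u] at h0 h1
    ext e
    fin_cases e
    · have : ((D i1 0 - D i0 0 : ℤ) : ℝ) = 0 := h1
      have : D i1 0 - D i0 0 = 0 := by exact_mod_cast this
      simp; omega
    · have : -((D i1 1 - D i0 1 : ℤ) : ℝ) = 0 := h0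
      have : D i1 1 - D i0 1 = 0 := by
        have := neg_eq_zero.1 this
        exact_mod_cast this
      simp; omega
  have hz : ∀ t : ℝ, mask (digitR D) (jv p a 1 + t • u) = 0 := by
    intro t
    have h1 : mask (digitR D) (jv p a 1) = 0 := by
      rw [hZ.2]
      exact ⟨1, le_rfl, by omega, 0, fun i => by simp [jv]⟩
    have h2 : mask (digitR D) (jv p a 1 + t • u)
        = mask (digitR D) (jv p a 1) * expChar (t • u) (digitR D i0) := by
      unfold mask
      rw [mul_assoc, Finset.sum_mul]
      congr 1
      refine Finset.sum_congr rfl fun i _ => ?_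
      rw [expChar_add_left]
      congr 1
      unfold expChar
      congr 3
      have := hcon i1 i i0
      have h3 : (((D i1 0 - D i0 0) * (D i 1 - D i0 1) - (D i1 1 - D i0 1) * (D i 0 - D i0 0) : ℤ) : ℝ) = 0 := by
        exact_mod_cast this
      push_cast at h3
      simp [u, digitR]
      linear_combination t * h3
    rw [h2, h1, zero_mul]
  have h3 := (hZ.2 _).1 (hz (1 / (2 * p * u e)))
  obtain ⟨j, -, -, k, hk⟩ := h3
  have h4 := hk e
  have h5 : (2 * a e + 1 : ℝ) = 2 * (j * a e + p * k e) := by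
    simp only [jv, Pi.add_apply, Pi.smul_apply, smul_eq_mul, Nat.cast_one] at h4
    field_simp at h4
    linear_combination h4
  have h6 : (2 * a e + 1 : ℤ) = 2 * (j * a e + p * k e) := by exact_mod_cast h5
  omega

lemma mask_gen {p : ℕ} (hp : p.Prime) (D : Fin p → (Fin 2 → ℤ)) (hD : Function.Injective D)
    (a : Fin 2 → ℤ) (hZ : ZeroSetCond p D a) :
    ∃ q : ℤ, q ≠ 0 ∧ (∀ x, ‖mask (digitR D) x‖ < 1 ∨ ∃ N : ℤ, q * x 0 = N) ∧
    ∀ δ > 0, ∃ η, 0 ≤ η ∧ η < 1 ∧ ∀ x, ‖mask (digitR D) x‖ ≤ η ∨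
      ∃ N : ℤ, |q * x 0 - N| < δ := by
  obtain ⟨i, j, k, hq⟩ := exists_det hp D hD a hZ
  set q := (D i 0 - D k 0) * (D j 1 - D k 1) - (D i 1 - D k 1) * (D j 0 - D k 0) with hqdef
  have h1 : ∀ x, ‖mask (digitR D) x‖ < 1 ∨ ∃ N : ℤ, q * x 0 = N := by
    intro x
    rcases lt_or_ge ‖mask (digitR D) x‖ 1 with h | h
    · exact Or.inl h
    right
    obtain ⟨N1, hN1⟩ := expChar_int_of_eq _ _ _ (mask_norm_one_eq hp.pos _ x h i k)
    obtain ⟨N2, hN2⟩ := expChar_int_of_eq _ _ _ (mask_norm_one_eq hp.pos _ x h j k)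
    refine ⟨N1 * (D j 1 - D k 1) - N2 * (D i 1 - D k 1), ?_⟩
    rw [hqdef]
    push_cast
    rw [← hN1, ← hN2]
    simp only [digitR]
    ring
  refine ⟨q, hq, h1, ?_⟩
  intro δ hδ
  let B : Set V2 := Set.Icc 0 1
  have hB : IsCompact B := isCompact_Icc
  let C : Set V2 := B ∩ {x | ∀ N : ℤ, δ ≤ |q * x 0 - N|}
  have hC : IsCompact C := by
    apply hB.inter_right
    have : {x : V2 | ∀ N : ℤ, δ ≤ |q * x 0 - N|} = ⋂ N : ℤ, {x : V2 | δ ≤ |q * x 0 - N|} := by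
      ext x; simp
    rw [this]
    exact isClosed_iInter fun N => isClosed_le continuous_const (by fun_prop)
  have hCs : ∀ x ∈ C, ‖mask (digitR D) x‖ < 1 := by
    intro x hx
    rcases h1 x with h | ⟨N, hN⟩
    · exact h
    · have := hx.2 N
      rw [hN, sub_self, abs_zero] at this
      linarith
  obtain ⟨η, hη0, hη1, hη⟩ : ∃ η : ℝ, 0 ≤ η ∧ η < 1 ∧ ∀ x ∈ C, ‖mask (digitR D) x‖ ≤ η := by
    rcases C.eq_empty_or_nonempty with h | h
    · exact ⟨0, le_rfl, by norm_num, by simp [h]⟩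
    · obtain ⟨x, hx, hmax⟩ := hC.exists_isMaxOn h
        (f := fun x => ‖mask (digitR D) x‖) (mask_continuous hp.pos _).norm.continuousOn
      exact ⟨_, norm_nonneg _, hCs x hx, fun y hy => hmax hy⟩
  refine ⟨η, hη0, hη1, fun x => ?_⟩
  by_cases hx : ∃ N : ℤ, |q * x 0 - N| < δ
  · exact Or.inr hx
  left
  push Not at hx
  have e : x + intV (fun i => -⌊x i⌋) ∈ C := by
    refine ⟨⟨fun i => ?_, fun i => ?_⟩, fun N => ?_⟩
    · change (0:ℝ) ≤ x i + ((-⌊x i⌋ : ℤ) : ℝ)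
      push_cast
      linarith [Int.floor_le (x i)]
    · change x i + ((-⌊x i⌋ : ℤ) : ℝ) ≤ 1
      push_cast
      linarith [Int.lt_floor_add_one (x i)]
    · have := hx (N + q * ⌊x 0⌋)
      have e2 : (q : ℝ) * (x 0 + ((-⌊x 0⌋ : ℤ) : ℝ)) - N
          = q * x 0 - ((N + q * ⌊x 0⌋ : ℤ) : ℝ) := by
        push_cast
        ring
      change δ ≤ |(q : ℝ) * (x 0 + ((-⌊x 0⌋ : ℤ) : ℝ)) - N|
      rw [e2]
      exact this
  rw [← mask_per D x (fun i => -⌊x i⌋)]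
  exact hη _ e

lemma sys_mk {p : ℕ} (hp : p.Prime) {ρ c : ℝ} (hρ0 : 0 < ρ) (hρ1 : ρ < 1)
    (D : Fin p → (Fin 2 → ℤ)) (hD : Function.Injective D)
    (a : Fin 2 → ℤ) (hZ : ZeroSetCond p D a)
    (μ : Measure (Fin 2 → ℝ)) (hμ : IsSelfAffine μ (Mupper ρ ρ c) (digitR D)) :
    Sys p ρ⁻¹ c a (mask (digitR D)) (ftMeasure μ) := by
  have hpr := hμ.1
  have hpR : (p : ℝ) ≠ 0 := by exact_mod_cast hp.ne_zero
  have hz : ∀ x, mask (digitR D) x = 0 ↔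
      ∃ j : ℕ, 1 ≤ j ∧ j ≤ p - 1 ∧ ∃ k, x = jv p a j + intV k := by
    intro x
    rw [hZ.2]
    refine exists_congr fun j => and_congr_right fun _ => and_congr_right fun _ =>
      exists_congr fun k => ?_
    rw [funext_iff]
    rfl
  refine ⟨hp, (one_lt_inv₀ hρ0).2 hρ1, ?_, fun x k => mask_per D x k, hz, ?_,
    mask_le hp.pos _, mask_isFT hp.pos _, ⟨μ, hpr, rfl⟩, ft_continuous μ, ft_zero μ, ft_norm_le μ,
    ft_rec hρ0.ne' _ μ hμ, mask_gen hp D hD a hZ⟩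
  · intro i hd
    have := hZ.1 i
    have := Int.le_of_dvd (by omega) hd
    omega
  · intro η
    apply mask_had hp.pos _ (fun j : Fin p => jv p a j)
    intro j j' hjj
    rw [hz]
    have hj := j.2
    have hj' := j'.2
    have hne : (j : ℕ) ≠ j' := fun h => hjj (Fin.ext h)
    rcases lt_or_gt_of_ne hne with h | h
    · refine ⟨p + j - j', by omega, by omega, -a, ?_⟩
      ext i
      simp only [jv, intV, Pi.sub_apply, Pi.add_apply, Pi.neg_apply]
      rw [Nat.cast_sub (by omega)]
      push_cast
      field_simp
      ring
    · refine ⟨j - j', by omega, by omega, 0, ?_⟩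
      ext i
      simp only [jv, intV, Pi.sub_apply, Pi.add_apply, Pi.zero_apply]
      rw [Nat.cast_sub (by omega)]
      push_cast
      field_simp
      ring

/-- weighted norm -/
def nrm (A : ℝ) (v : V2) : ℝ := A * |v 0| + |v 1|

lemma nrm_nonneg {A : ℝ} (hA : 1 ≤ A) (v : V2) : 0 ≤ nrm A v := by
  unfold nrm; positivity

lemma nrm_add {A : ℝ} (hA : 1 ≤ A) (v w : V2) : nrm A (v + w) ≤ nrm A v + nrm A w := by
  unfold nrm
  have h0 := abs_add_le (v 0) (w 0)
  have h1 := abs_add_le (v 1) (w 1)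
  simp only [Pi.add_apply]
  nlinarith

lemma norm_le_nrm {A : ℝ} (hA : 1 ≤ A) (v : V2) : ‖v‖ ≤ nrm A v := by
  have h0 := abs_nonneg (v 0)
  have h1 := abs_nonneg (v 1)
  rw [pi_norm_le_iff_of_nonneg (nrm_nonneg hA v)]
  intro i
  unfold nrm
  fin_cases i
  · simp; nlinarith
  · simp; nlinarith

lemma continuous_nrm (A : ℝ) : Continuous (nrm A) := by
  unfold nrm; fun_prop

lemma nrm_zero (A : ℝ) : nrm A 0 = 0 := by simp [nrm]

lemma exists_nrm {b : ℝ} (hb : 1 < b) (c : ℝ) : ∃ A κ : ℝ, 1 ≤ A ∧ 0 < κ ∧ κ < 1 ∧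
    ∀ v, nrm A (Tm b c v) ≤ κ * nrm A v := by
  have hb0 : 0 < b := by linarith
  have hi : b⁻¹ < 1 := inv_lt_one_of_one_lt₀ hb
  have hi0 : 0 < b⁻¹ := inv_pos.2 hb0
  have h1 : 0 < 1 - b⁻¹ := by linarith
  refine ⟨2 * |c| * b⁻¹ ^ 2 / (1 - b⁻¹) + 1, (1 + b⁻¹) / 2, ?_, by positivity, by linarith, ?_⟩
  · have : 0 ≤ 2 * |c| * b⁻¹ ^ 2 / (1 - b⁻¹) := by positivity
    linarith
  · intro v
    set A := 2 * |c| * b⁻¹ ^ 2 / (1 - b⁻¹) + 1 with hA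
    have hA' : |c| * b⁻¹ ^ 2 = (A - 1) * (1 - b⁻¹) / 2 := by
      rw [hA, add_sub_cancel_right, div_mul_cancel₀ _ h1.ne']; ring
    unfold nrm
    rw [Tm_zero', Tm_one', abs_mul, abs_of_pos hi0]
    have h2 : |b⁻¹ * v 1 - c * b⁻¹ ^ 2 * v 0| ≤ b⁻¹ * |v 1| + |c| * b⁻¹ ^ 2 * |v 0| := by
      refine (abs_sub _ _).trans ?_
      rw [abs_mul, abs_mul, abs_mul, abs_of_pos hi0, abs_of_pos (by positivity : 0 < b⁻¹ ^ 2)]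
    rw [hA'] at h2
    have h0 := abs_nonneg (v 0)
    have h1' := abs_nonneg (v 1)
    nlinarith [mul_nonneg h1.le h0, mul_nonneg h1.le h1']

lemma nrm_pow {A κ : ℝ} (T : V2 →ₗ[ℝ] V2) (h0 : 0 ≤ κ)
    (hT : ∀ v, nrm A (T v) ≤ κ * nrm A v) (k : ℕ) (v : V2) :
    nrm A ((T ^ k) v) ≤ κ ^ k * nrm A v := by
  induction k with
  | zero => simp
  | succ k ih =>
    rw [pow_succ', Module.End.mul_apply]
    calc _ ≤ κ * nrm A ((T ^ k) v) := hT _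
      _ ≤ κ * (κ ^ k * nrm A v) := by gcongr
      _ = _ := by ring

lemma Tm_pow_tendsto {b : ℝ} (hb : 1 < b) (c : ℝ) (v : V2) :
    Filter.Tendsto (fun k => (Tm b c ^ k) v) Filter.atTop (nhds 0) := by
  obtain ⟨A, κ, hA, h0, h1, hT⟩ := exists_nrm hb c
  rw [tendsto_zero_iff_norm_tendsto_zero]
  refine squeeze_zero (fun _ => norm_nonneg _) (fun k => (norm_le_nrm hA _).trans
    (nrm_pow _ h0.le hT k v)) ?_
  have := (tendsto_pow_atTop_nhds_zero_of_lt_one h0.le h1).mul_const (nrm A v)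
  simpa using this

/-- partial products -/
def Fn (b c : ℝ) (m : V2 → ℂ) (n : ℕ) (x : V2) : ℂ :=
  ∏ k ∈ Finset.range n, m ((Tm b c ^ (k + 1)) x)

section
variable {p : ℕ} {b c : ℝ} {a : Fin 2 → ℤ} {m F : V2 → ℂ}

lemma Sys.F_eq (S : Sys p b c a m F) (n : ℕ) (x : V2) :
    F x = Fn b c m n x * F ((Tm b c ^ n) x) := by
  induction n with
  | zero => simp [Fn]
  | succ n ih =>
    rw [ih, S.Frec]
    unfold Fn
    rw [Finset.prod_range_succ, pow_succ', Module.End.mul_apply]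
    ring

lemma Sys.Fn_FT (S : Sys p b c a m F) (n : ℕ) : IsFT (Fn b c m n) := by
  unfold Fn
  exact IsFT.prod _ _ fun i _ => S.mFT.comp _

lemma Sys.Fn_zero (n : ℕ) (x : V2) :
    Fn b c m n x = 0 ↔ ∃ k, 1 ≤ k ∧ k ≤ n ∧ m ((Tm b c ^ k) x) = 0 := by
  unfold Fn
  rw [Finset.prod_eq_zero_iff]
  constructor
  · rintro ⟨k, hk, h⟩
    exact ⟨k + 1, by omega, by have := Finset.mem_range.1 hk; omega, h⟩
  · rintro ⟨k, h1, h2, h⟩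
    exact ⟨k - 1, Finset.mem_range.2 (by omega), by rwa [Nat.sub_add_cancel h1]⟩

lemma Sys.F_zero (S : Sys p b c a m F) (x : V2) :
    F x = 0 ↔ ∃ k, 1 ≤ k ∧ m ((Tm b c ^ k) x) = 0 := by
  constructor
  · intro h
    by_contra hcon
    push Not at hcon
    have h1 : Filter.Tendsto (fun k => F ((Tm b c ^ k) x)) Filter.atTop (nhds (F 0)) :=
      (S.Fcont.tendsto 0).comp (Tm_pow_tendsto S.hb c x)
    rw [S.F0] at h1
    obtain ⟨k, hk⟩ := (h1.eventually_ne one_ne_zero).exists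
    have h2 := S.F_eq k x
    rw [h] at h2
    rcases mul_eq_zero.1 h2.symm with h3 | h3
    · obtain ⟨k, h1, -, h⟩ := (Sys.Fn_zero _ _).1 h3
      exact hcon k h1 h
    · exact hk h3
  · rintro ⟨k, h1, h⟩
    rw [S.F_eq k, (Sys.Fn_zero k x).2 ⟨k, h1, le_rfl, h⟩, zero_mul]

lemma Sys.bpos (S : Sys p b c a m F) : 0 < b := by linarith [S.hb]

lemma Sys.ppos (S : Sys p b c a m F) : (0 : ℝ) < p := by exact_mod_cast S.hp.pos

lemma Sys.pint (S : Sys p b c a m F) : Prime (p : ℤ) := Nat.prime_iff_prime_int.1 S.hp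

lemma Sys.zero' (S : Sys p b c a m F) (x : V2) : m x = 0 ↔
    ∃ (w : Fin 2 → ℤ) (j : ℤ), ¬ (p : ℤ) ∣ j ∧ (∀ i, (p : ℤ) ∣ w i - j * a i) ∧
      ∀ i, (p : ℝ) * x i = w i := by
  have hp0 := S.ppos
  rw [S.zero]
  constructor
  · rintro ⟨j, h1, h2, k, rfl⟩
    refine ⟨fun i => j * a i + p * k i, j, ?_, ?_, ?_⟩
    · intro hd
      have := Int.le_of_dvd (by omega) hd
      have := S.hp.pos
      omega
    · intro i
      exact ⟨k i, by ring⟩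
    · intro i
      simp only [Pi.add_apply, jv, intV]
      push_cast
      field_simp
  · rintro ⟨w, j, hj, hw, hx⟩
    have hpz : (p : ℤ) ≠ 0 := by exact_mod_cast S.hp.ne_zero
    have h0 := Int.emod_nonneg j hpz
    have hlt := Int.emod_lt_of_pos j (by have := S.hp.pos; omega : (0:ℤ) < p)
    have hne : j % p ≠ 0 := fun h => hj (Int.dvd_of_emod_eq_zero h)
    choose k hk using hw
    have hcast : (((j % p).toNat : ℕ) : ℤ) = j % p := Int.toNat_of_nonneg h0
    refine ⟨(j % p).toNat, by omega, by omega, fun i => k i + (j / p) * a i, ?_⟩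
    ext i
    have e : w i = (j % p) * a i + p * (k i + (j / p) * a i) := by
      have := Int.emod_add_mul_ediv j p
      have := hk i
      linear_combination this + (- a i) * Int.emod_add_mul_ediv j p
    simp only [Pi.add_apply, jv, intV]
    have hcr : (((j % p).toNat : ℕ) : ℝ) = ((j % p : ℤ) : ℝ) := by exact_mod_cast hcast
    rw [hcr]
    have e' : (w i : ℝ) = ((j % p : ℤ) : ℝ) * a i + p * ((k i + (j / p) * a i : ℤ) : ℝ) := by
      rw [e]; push_cast; ring
    have := hx i
    rw [e'] at this
    field_simp
    linarith

lemma Sys.not_dvd (S : Sys p b c a m F) {w j : ℤ} {i : Fin 2} (hj : ¬ (p : ℤ) ∣ j)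
    (h : (p : ℤ) ∣ w - j * a i) : ¬ (p : ℤ) ∣ w := by
  intro hw
  have : (p : ℤ) ∣ j * a i := by
    have := dvd_sub hw h
    simpa using this
  rcases S.pint.dvd_or_dvd this with h | h
  · exact hj h
  · exact S.ha i h

end

lemma sum_range_split (q n : ℕ) (hq : 0 < q) (f : ℕ → ℝ) :
    ∑ i ∈ Finset.range (n * q), f i
      = ∑ r ∈ Finset.range q, ∑ i ∈ Finset.range n, f (r + q * i) := by
  rw [← Finset.sum_product']
  symm
  apply Finset.sum_nbij' (fun x => x.1 + q * x.2) (fun i => (i % q, i / q))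
  · rintro ⟨r, i⟩ h
    simp only [Finset.mem_product, Finset.mem_range] at h ⊢
    have : q * (i + 1) ≤ q * n := Nat.mul_le_mul_left _ h.2
    rw [mul_comm n q]
    nlinarith
  · intro i h
    simp only [Finset.mem_product, Finset.mem_range] at h ⊢
    exact ⟨Nat.mod_lt _ hq, (Nat.div_lt_iff_lt_mul hq).2 h⟩
  · rintro ⟨r, i⟩ h
    simp only [Finset.mem_product, Finset.mem_range] at h
    ext
    · simp [Nat.mod_eq_of_lt h.1]
    · simp [Nat.add_mul_div_left _ _ hq, Nat.div_eq_of_lt h.1]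
  · intro i _
    exact Nat.mod_add_div i q
  · rintro ⟨r, i⟩ _
    rfl

/-- the digit expansion sequence -/
def lamSeq (q : ℕ) (N : V2 →ₗ[ℝ] V2) (x : ℕ → V2) (i : ℕ) : V2 :=
  if _h : i = 0 ∨ q < 2 then 0 else N (x (i % q)) + N (lamSeq q N x (i / q))
termination_by i
decreasing_by exact Nat.div_lt_self (by omega) (by omega)

lemma lamSeq_zero (q : ℕ) (N : V2 →ₗ[ℝ] V2) (x : ℕ → V2) : lamSeq q N x 0 = 0 := by
  rw [lamSeq]; simp

lemma lamSeq_rec {q : ℕ} (hq : 2 ≤ q) (N : V2 →ₗ[ℝ] V2) (x : ℕ → V2) (hx : x 0 = 0) (i : ℕ) :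
    lamSeq q N x i = N (x (i % q)) + N (lamSeq q N x (i / q)) := by
  rcases Nat.eq_zero_or_pos i with h | h
  · subst h
    simp [lamSeq_zero, hx]
  · conv_lhs => rw [lamSeq]
    rw [dif_neg (by omega)]

lemma lamSeq_mem {q : ℕ} (hq : 2 ≤ q) (N : V2 →ₗ[ℝ] V2) (x : ℕ → V2) (hx0 : x 0 = 0)
    (Γ : AddSubgroup V2) (hN : ∀ γ ∈ Γ, N γ ∈ Γ) (hx : ∀ r < q, N (x r) ∈ Γ) (i : ℕ) :
    lamSeq q N x i ∈ Γ := by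
  induction i using Nat.strong_induction_on with
  | _ i ih =>
    rcases Nat.eq_zero_or_pos i with h | h
    · subst h
      rw [lamSeq_zero]; exact Γ.zero_mem
    · rw [lamSeq_rec hq N x hx0]
      exact Γ.add_mem (hx _ (Nat.mod_lt _ (by omega)))
        (hN _ (ih _ (Nat.div_lt_self h (by omega))))

lemma tile (g : V2 → ℂ) {q : ℕ} (hq : 2 ≤ q) (N T : V2 →ₗ[ℝ] V2) (hTN : ∀ v, T (N v) = v)
    (Γ : AddSubgroup V2) (hΓ : ∀ x, ∀ γ ∈ Γ, ‖g (x + γ)‖ = ‖g x‖) (hN : ∀ γ ∈ Γ, N γ ∈ Γ)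
    (x : ℕ → V2) (hx0 : x 0 = 0) (hx : ∀ r < q, N (x r) ∈ Γ)
    (hsum : ∀ η, ∑ r ∈ Finset.range q, ‖g (η + x r)‖ ^ 2 = 1) (k : ℕ) (ξ : V2) :
    ∑ i ∈ Finset.range (q ^ k),
      ‖∏ l ∈ Finset.range k, g ((T ^ (l + 1)) (ξ + lamSeq q N x i))‖ ^ 2 = 1 := by
  induction k generalizing ξ with
  | zero => simp
  | succ k ih =>
    rw [pow_succ, sum_range_split q _ (by omega), ← hsum (T ξ)]
    refine Finset.sum_congr rfl fun r hr => ?_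
    have hr' := Finset.mem_range.1 hr
    rw [← mul_one (‖g (T ξ + x r)‖ ^ 2), ← ih (T ξ + x r), Finset.mul_sum]
    refine Finset.sum_congr rfl fun i _ => ?_
    have e : T (ξ + lamSeq q N x (r + q * i)) = T ξ + x r + lamSeq q N x i := by
      rw [lamSeq_rec hq N x hx0, map_add, map_add, hTN, hTN, Nat.add_mul_mod_self_left,
        Nat.mod_eq_of_lt hr', Nat.add_mul_div_left _ _ (by omega), Nat.div_eq_of_lt hr', zero_add,
        add_assoc]
    rw [Finset.prod_range_succ', norm_mul, mul_pow, mul_comm]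
    have e1 : ∀ l, (T ^ (l + 1 + 1)) (ξ + lamSeq q N x (r + q * i))
        = (T ^ (l + 1)) (T ξ + x r + lamSeq q N x i) := by
      intro l
      rw [pow_succ T (l + 1), Module.End.mul_apply, e]
    simp_rw [e1]
    rw [zero_add, pow_one, e, hΓ _ _ (lamSeq_mem hq N x hx0 Γ hN hx i)]

lemma lam_near {q : ℕ} (hq : 2 ≤ q) (N T : V2 →ₗ[ℝ] V2) (hTN : ∀ v, T (N v) = v)
    {A κ : ℝ} (hA : 1 ≤ A) (h0 : 0 ≤ κ) (hT : ∀ v, nrm A (T v) ≤ κ * nrm A v)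
    (x : ℕ → V2) (hx0 : x 0 = 0) {R : ℝ} (hR : ∀ r < q, nrm A (x r) ≤ R) (k : ℕ) :
    ∀ i < q ^ (k + 1), ∃ r < q,
      nrm A ((T ^ (k + 1)) (lamSeq q N x i) - x r) ≤ R * ∑ l ∈ Finset.range k, κ ^ (l + 1) := by
  induction k with
  | zero =>
    intro i hi
    rw [zero_add, pow_one] at hi
    refine ⟨i, hi, ?_⟩
    rw [lamSeq_rec hq N x hx0, zero_add, pow_one, map_add, hTN, hTN, Nat.mod_eq_of_lt hi,
      Nat.div_eq_of_lt hi, lamSeq_zero]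
    simp [nrm_zero]
  | succ k ih =>
    intro i hi
    have hi' : i / q < q ^ (k + 1) := by
      rw [Nat.div_lt_iff_lt_mul (by omega)]
      rwa [pow_succ] at hi
    obtain ⟨r, hr, h⟩ := ih _ hi'
    refine ⟨r, hr, ?_⟩
    have e : (T ^ (k + 1 + 1)) (lamSeq q N x i) - x r
        = (T ^ (k + 1)) (x (i % q)) + ((T ^ (k + 1)) (lamSeq q N x (i / q)) - x r) := by
      rw [pow_succ T (k + 1), Module.End.mul_apply, lamSeq_rec hq N x hx0, map_add, hTN, hTN,
        map_add, add_sub_assoc]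
    rw [e, Finset.sum_range_succ, mul_add]
    refine (nrm_add hA _ _).trans ?_
    rw [add_comm]
    refine add_le_add h ?_
    refine (nrm_pow T h0 hT _ _).trans ?_
    rw [mul_comm R]
    exact mul_le_mul_of_nonneg_left (hR _ (Nat.mod_lt _ (by omega))) (by positivity)

/-- Geometric series bound. -/
lemma geom_bound {κ : ℝ} (h0 : 0 ≤ κ) (h1 : κ < 1) (k : ℕ) :
    ∑ l ∈ Finset.range k, κ ^ (l + 1) ≤ κ / (1 - κ) := by
  have h2 : 0 < 1 - κ := by linarith
  rw [le_div_iff₀ h2]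
  have := geom_sum_mul_neg κ k
  have e : ∑ l ∈ Finset.range k, κ ^ (l + 1) = κ * ∑ l ∈ Finset.range k, κ ^ l := by
    rw [Finset.mul_sum]
    exact Finset.sum_congr rfl fun l _ => by ring
  rw [e, mul_assoc, this]
  have : 0 ≤ κ ^ k := by positivity
  nlinarith

/-- Final analytic step: dominated convergence. -/
lemma hasSum_of_tile {F : V2 → ℂ} (hF : Continuous F) (hF0 : F 0 = 1) (hFle : ∀ x, ‖F x‖ ≤ 1)
    (T : V2 →ₗ[ℝ] V2) (G : ℕ → V2 → ℂ) (hG : ∀ k x, F x = G k x * F ((T ^ k) x))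
    (hT : ∀ v, Filter.Tendsto (fun k => (T ^ k) v) Filter.atTop (nhds 0))
    {q : ℕ} (hq : 2 ≤ q) (l : ℕ → V2)
    (hsum : ∀ k ξ, ∑ i ∈ Finset.range (q ^ k), ‖G k (ξ + l i)‖ ^ 2 = 1)
    {ε : ℝ} (hε : 0 < ε) (hlow : ∀ ξ, ∃ K, ∀ k ≥ K, ∀ i < q ^ k, ε ≤ ‖F ((T ^ k) (ξ + l i))‖)
    (ξ : V2) : HasSum (fun i => ‖F (ξ + l i)‖ ^ 2) 1 := by
  have hle : ∀ k x, ‖F x‖ ≤ ‖G k x‖ := by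
    intro k x
    rw [hG k x, norm_mul]
    exact mul_le_of_le_one_right (norm_nonneg _) (hFle _)
  have hsF : Summable (fun i => ‖F (ξ + l i)‖ ^ 2) := by
    apply summable_of_sum_range_le (c := 1) (fun _ => by positivity)
    intro n
    rw [← hsum n ξ]
    calc _ ≤ ∑ i ∈ Finset.range (q ^ n), ‖F (ξ + l i)‖ ^ 2 := by
            apply Finset.sum_le_sum_of_subset_of_nonneg
            · exact Finset.range_subset_range.2 (Nat.lt_pow_self (by omega)).le
            · intro i _ _; positivity
      _ ≤ _ := by
            refine Finset.sum_le_sum fun i _ => ?_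
            exact pow_le_pow_left₀ (norm_nonneg _) (hle _ _) 2
  let f : ℕ → ℕ → ℝ := fun k i => if i < q ^ k then ‖G k (ξ + l i)‖ ^ 2 else 0
  have hf1 : ∀ k, ∑' i, f k i = 1 := by
    intro k
    rw [tsum_eq_sum (s := Finset.range (q ^ k))]
    · rw [← hsum k ξ]
      refine Finset.sum_congr rfl fun i hi => ?_
      simp only [f]
      rw [if_pos (Finset.mem_range.1 hi)]
    · intro i hi
      simp only [f]
      rw [if_neg (fun h => hi (Finset.mem_range.2 h))]
  obtain ⟨K, hK⟩ := hlow ξ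
  have hlim : Filter.Tendsto (fun k => ∑' i, f k i) Filter.atTop
      (nhds (∑' i, ‖F (ξ + l i)‖ ^ 2)) := by
    apply tendsto_tsum_of_dominated_convergence (bound := fun i => (ε⁻¹) ^ 2 * ‖F (ξ + l i)‖ ^ 2)
    · exact hsF.mul_left _
    · intro i
      have h1 : Filter.Tendsto (fun k => ‖F ((T ^ k) (ξ + l i))‖ ^ 2) Filter.atTop (nhds 1) := by
        have := (((hF.tendsto 0).comp (hT (ξ + l i))).norm).pow 2
        simpa [hF0] using this
      have h2 : Filter.Tendsto (fun k => ‖F (ξ + l i)‖ ^ 2 / ‖F ((T ^ k) (ξ + l i))‖ ^ 2)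
          Filter.atTop (nhds (‖F (ξ + l i)‖ ^ 2)) := by
        have := (tendsto_const_nhds (x := ‖F (ξ + l i)‖ ^ 2)).div h1 one_ne_zero
        rw [div_one] at this
        exact this
      refine h2.congr' ?_
      filter_upwards [h1.eventually_ne one_ne_zero, Filter.eventually_ge_atTop i] with k hk hki
      have : i < q ^ k := lt_of_le_of_lt hki (Nat.lt_pow_self (by omega))
      simp only [f]
      rw [if_pos this, hG k, norm_mul, mul_pow, mul_div_cancel_right₀ _ hk]
    · filter_upwards [Filter.eventually_ge_atTop K] with k hk i
      simp only [f]
      split_ifs with h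
      · have h1 := hK k hk i h
        rw [Real.norm_of_nonneg (by positivity), hG k, norm_mul, ← mul_pow]
        apply pow_le_pow_left₀ (norm_nonneg _)
        rw [mul_comm, mul_assoc]
        apply le_mul_of_one_le_right (norm_nonneg _)
        rw [← div_eq_mul_inv, le_div_iff₀ hε, one_mul]
        exact h1
      · simp; positivity
  simp_rw [hf1] at hlim
  have := tendsto_nhds_unique hlim tendsto_const_nhds
  rw [← this]
  exact hsF.hasSum

section
variable {p : ℕ} {b c : ℝ} {a : Fin 2 → ℤ} {m F : V2 → ℂ}

/-- second unit vector -/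
def e2 : V2 := ![0, 1]

lemma Tm_pow_e2 (b c : ℝ) (k : ℕ) : (Tm b c ^ k) e2 = ![0, b⁻¹ ^ k] := by
  induction k with
  | zero => simp [e2]
  | succ k ih =>
    rw [pow_succ', Module.End.mul_apply, ih]
    ext i
    fin_cases i
    · simp [Tm_zero']
    · simp [Tm_one', pow_succ']

lemma Sys.F_or (S : Sys p b c a m F) {n : ℤ} (hn : (p : ℤ) ∣ n) (hbn : b = n) (ξ : V2) :
    F ξ ≠ 0 ∨ F (ξ + e2) ≠ 0 := by
  by_contra hcon
  push Not at hcon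
  obtain ⟨h1, h2⟩ := hcon
  obtain ⟨k, hk, h1⟩ := (S.F_zero _).1 h1
  obtain ⟨k', hk', h2⟩ := (S.F_zero _).1 h2
  obtain ⟨w, j, hj, hw, hx⟩ := (S.zero' _).1 h1
  obtain ⟨w', j', hj', hw', hx'⟩ := (S.zero' _).1 h2
  have hb0 := S.bpos
  have hb0' : b ≠ 0 := hb0.ne'
  have hn0 : n ≠ 0 := by rintro rfl; simp at hbn; exact hb0' hbn
  have e0 := hx 0
  have e0' := hx' 0
  rw [Tm_pow_zero'] at e0 e0'
  simp only [Pi.add_apply, e2, Matrix.cons_val_zero, add_zero] at e0'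
  have E : b ^ k * w 0 = b ^ k' * w' 0 := by
    rw [← e0, ← e0', inv_pow, inv_pow]
    field_simp
  have E' : n ^ k * w 0 = n ^ k' * w' 0 := by
    rw [hbn] at E
    exact_mod_cast E
  have hkk : k = k' := by
    rcases lt_trichotomy k k' with h | h | h
    · exfalso
      apply S.not_dvd hj (hw 0)
      have : w 0 = n ^ (k' - k) * w' 0 := by
        apply mul_left_cancel₀ (pow_ne_zero k hn0)
        rw [E', ← mul_assoc, ← pow_add]
        congr 2
        omega
      rw [this]
      exact Dvd.dvd.mul_right (hn.trans (dvd_pow_self _ (by omega))) _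
    · exact h
    · exfalso
      apply S.not_dvd hj' (hw' 0)
      have : w' 0 = n ^ (k - k') * w 0 := by
        apply mul_left_cancel₀ (pow_ne_zero k' hn0)
        rw [← E', ← mul_assoc, ← pow_add]
        congr 2
        omega
      rw [this]
      exact Dvd.dvd.mul_right (hn.trans (dvd_pow_self _ (by omega))) _
  subst hkk
  have hw0 : w 0 = w' 0 := mul_left_cancel₀ (pow_ne_zero k hn0) E'
  have hjj : (p : ℤ) ∣ j - j' := by
    have h3 : (p : ℤ) ∣ (j - j') * a 0 := by
      have := dvd_sub (hw' 0) (hw 0)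
      rw [hw0] at this
      rw [show (j - j') * a 0 = w' 0 - j' * a 0 - (w' 0 - j * a 0) by ring]
      exact this
    rcases S.pint.dvd_or_dvd h3 with h | h
    · exact h
    · exact absurd h (S.ha 0)
  have hw1 : (p : ℤ) ∣ w' 1 - w 1 := by
    have := dvd_sub (dvd_sub (hw' 1) (hw 1)) (hjj.mul_right (a 1))
    rw [show w' 1 - w 1 = w' 1 - j' * a 1 - (w 1 - j * a 1) - (j - j') * a 1 by ring]
    exact this
  obtain ⟨z, hz⟩ := hw1
  have e1 := hx 1
  have e1' := hx' 1
  rw [map_add, Pi.add_apply, Tm_pow_e2, mul_add, e1] at e1'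
  have e3 : (p : ℝ) * b⁻¹ ^ k = p * z := by
    have : ((w' 1 - w 1 : ℤ) : ℝ) = ((p * z : ℤ) : ℝ) := by rw [hz]
    push_cast at this
    rw [← this, ← e1']
    simp
  have e4 : b⁻¹ ^ k = z := mul_left_cancel₀ S.ppos.ne' e3
  have e5 : n ^ k * z = 1 := by
    have : b ^ k * z = 1 := by
      rw [← e4, ← mul_pow, mul_inv_cancel₀ hb0', one_pow]
    rw [hbn] at this
    exact_mod_cast this
  have : (p : ℤ) ∣ 1 := by
    rw [← e5]
    exact Dvd.dvd.mul_right (hn.trans (dvd_pow_self _ (by omega))) _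
  exact S.pint.not_isUnit (isUnit_of_dvd_one this)

lemma isCompact_nrm {A : ℝ} (hA : 1 ≤ A) (R : ℝ) : IsCompact {v : V2 | nrm A v ≤ R} := by
  refine Metric.isCompact_of_isClosed_isBounded
    (isClosed_le (continuous_nrm A) continuous_const) ?_
  refine (Metric.isBounded_closedBall (x := (0 : V2)) (r := R)).subset ?_
  intro v hv
  rw [mem_closedBall_zero_iff]
  exact (norm_le_nrm hA v).trans hv

lemma Sys.low (S : Sys p b c a m F) {n : ℤ} (hn : (p : ℤ) ∣ n) (hbn : b = n)
    {A : ℝ} (hA : 1 ≤ A) (R : ℝ) (hR : 0 ≤ R) :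
    ∃ ε, 0 < ε ∧ ε ≤ 1 ∧ ∀ v, nrm A v ≤ R → ε ≤ ‖F v‖ ∨ ε ≤ ‖F (v + e2)‖ := by
  have hc : Continuous (fun v => ‖F v‖ ⊔ ‖F (v + e2)‖) := by
    have := S.Fcont
    fun_prop
  obtain ⟨v, hv, hmin⟩ := (isCompact_nrm hA R).exists_isMinOn
    ⟨0, by simpa [nrm_zero] using hR⟩ hc.continuousOn
  refine ⟨‖F v‖ ⊔ ‖F (v + e2)‖, ?_, sup_le (S.Fle _) (S.Fle _), ?_⟩
  · rcases S.F_or hn hbn v with h | h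
    · exact lt_sup_of_lt_left (norm_pos_iff.2 h)
    · exact lt_sup_of_lt_right (norm_pos_iff.2 h)
  · intro w hw
    have := hmin hw
    exact le_sup_iff.1 this

lemma Sys.unif (S : Sys p b c a m F) {A : ℝ} (hA : 1 ≤ A) (R : ℝ) {ε : ℝ} (hε : 0 < ε) :
    ∃ δ, 0 < δ ∧ ∀ v w, nrm A v ≤ R → nrm A (w - v) ≤ δ → ‖F w - F v‖ < ε := by
  have huc := (isCompact_nrm hA (R + 1)).uniformContinuousOn_of_continuous
    S.Fcont.continuousOn
  rw [Metric.uniformContinuousOn_iff] at huc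
  obtain ⟨δ, hδ, h⟩ := huc ε hε
  refine ⟨min (δ / 2) 1, by positivity, ?_⟩
  intro v w hv hw
  rw [← dist_eq_norm]
  apply h
  · have := nrm_add hA v (w - v)
    rw [add_sub_cancel] at this
    have h2 := hw.trans (min_le_right _ _)
    simp only [Set.mem_ofPred_eq]
    linarith
  · simp only [Set.mem_ofPred_eq]
    linarith
  · rw [dist_eq_norm]
    have := (norm_le_nrm hA (w - v)).trans (hw.trans (min_le_left _ _))
    linarith

/-- the lattice -/
def Gam (s : ℤ) : AddSubgroup V2 where
  carrier := {v | ∃ u v' : ℤ, v 0 = s * u ∧ v 1 = v'}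
  zero_mem' := ⟨0, 0, by simp, by simp⟩
  add_mem' := by
    rintro x y ⟨u, v, h1, h2⟩ ⟨u', v', h1', h2'⟩
    refine ⟨u + u', v + v', ?_, ?_⟩
    · simp [h1, h1']; ring
    · simp [h2, h2']
  neg_mem' := by
    rintro x ⟨u, v, h1, h2⟩
    exact ⟨-u, -v, by simp [h1], by simp [h2]⟩

lemma Gam_pow {s : ℤ} {U : V2 →ₗ[ℝ] V2} (h : ∀ γ ∈ Gam s, U γ ∈ Gam s) (k : ℕ) :
    ∀ γ ∈ Gam s, (U ^ k) γ ∈ Gam s := by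
  induction k with
  | zero => simp
  | succ k ih =>
    intro γ hγ
    rw [pow_succ', Module.End.mul_apply]
    exact h _ (ih γ hγ)

lemma Sys.per_Gam (S : Sys p b c a m F) {s : ℤ} (x : V2) {γ : V2} (hγ : γ ∈ Gam s) :
    m (x + γ) = m x := by
  obtain ⟨u, v, h1, h2⟩ := hγ
  have : γ = intV ![s * u, v] := by
    ext i
    fin_cases i
    · simp [intV, h1]
    · simp [intV, h2]
  rw [this, S.per]

lemma Sys.suff (S : Sys p b c a m F) {n : ℤ} (hn : (p : ℤ) ∣ n) (hbn : b = n) {t s : ℤ}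
    (hs : ¬ (p : ℤ) ∣ s) (ht : (p : ℤ) ∣ t) (hc : c * s = t) :
    ∃ l : ℕ → V2, ∀ ξ, HasSum (fun i => ‖F (ξ + l i)‖ ^ 2) 1 := by
  have hb0 : b ≠ 0 := S.bpos.ne'
  have hp0 := S.ppos.ne'
  have hp2 := S.hp.two_le
  set U := Um b c with hU
  set T := Tm b c with hT
  have hUΓ : ∀ γ ∈ Gam s, U γ ∈ Gam s := by
    rintro γ ⟨u, v, h1, h2⟩
    refine ⟨n * u, t * u + n * v, ?_, ?_⟩
    · rw [hU, Um_zero', h1, hbn]; push_cast; ring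
    · rw [hU, Um_one', h1, h2, hbn]; push_cast; rw [← hc]; ring
  obtain ⟨s', e, hse⟩ : ∃ s' e : ℤ, s * s' = 1 + p * e := by
    have : IsCoprime (p : ℤ) s := (Prime.coprime_iff_not_dvd S.pint).2 hs
    obtain ⟨x, y, h⟩ := this
    exact ⟨y, -x, by linear_combination h⟩
  have hseR : (s : ℝ) * s' = 1 + p * e := by exact_mod_cast hse
  let y : ℕ → V2 := fun r => ![(r : ℝ) * (s * s' * a 0) / p, (r : ℝ) * a 1 / p]
  have hy0 : y 0 = 0 := by
    ext i; fin_cases i <;> simp [y]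
  have hyΓ : ∀ r, U (y r) ∈ Gam s := by
    intro r
    obtain ⟨n1, rfl⟩ := hn
    obtain ⟨t1, rfl⟩ := ht
    refine ⟨n1 * r * s' * a 0, t1 * r * s' * a 0 + n1 * r * a 1, ?_, ?_⟩
    · rw [hU, Um_zero', hbn]
      simp only [y, Matrix.cons_val_zero]
      push_cast
      field_simp
    · rw [hU, Um_one', hbn]
      simp only [y, Matrix.cons_val_zero, Matrix.cons_val_one]
      push_cast at hc ⊢
      field_simp
      linear_combination ((r : ℝ) * s' * a 0) * hc
  have hysum : ∀ η, ∑ r ∈ Finset.range p, ‖m (η + y r)‖ ^ 2 = 1 := by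
    intro η
    rw [Finset.sum_range, ← S.had η]
    refine Finset.sum_congr rfl fun r _ => ?_
    have : η + y r = η + jv p a r + intV ![r * e * a 0, 0] := by
      ext i
      fin_cases i
      · simp [y, jv, intV]
        rw [hseR]
        field_simp
        ring
      · simp [y, jv, intV]
    rw [this, S.per]
  have htile1 := tile m hp2 U T (Tm_Um hb0) (Gam s) (fun x γ hγ => by rw [S.per_Gam x hγ]) hUΓ y hy0
    (fun r _ => hyΓ r) hysum
  set σ := lamSeq p U y with hσ
  have hσΓ : ∀ i, σ i ∈ Gam s := lamSeq_mem hp2 U y hy0 _ hUΓ (fun r _ => hyΓ r)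
  obtain ⟨A, κ, hA, hκ0, hκ1, hκ⟩ := exists_nrm S.hb c
  -- bound on y
  let Y : ℝ := ∑ r ∈ Finset.range p, nrm A (y r)
  have hY : ∀ r < p, nrm A (y r) ≤ Y := fun r hr =>
    Finset.single_le_sum (f := fun r => nrm A (y r)) (fun i _ => nrm_nonneg hA _)
      (Finset.mem_range.2 hr)
  have hY0 : 0 ≤ Y := Finset.sum_nonneg fun i _ => nrm_nonneg hA _
  have h1κ : 0 < 1 - κ := by linarith
  let R0 : ℝ := Y + Y * (κ / (1 - κ))
  have hR0 : 0 ≤ R0 := by positivity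
  have hσR : ∀ k, ∀ i < p ^ (k + 1), nrm A ((T ^ (k + 1)) (σ i)) ≤ R0 := by
    intro k i hi
    obtain ⟨r, hr, h⟩ := lam_near hp2 U T (Tm_Um hb0) hA hκ0.le hκ y hy0 hY k i hi
    have h2 := nrm_add hA (y r) ((T ^ (k + 1)) (σ i) - y r)
    rw [add_sub_cancel] at h2
    refine h2.trans (add_le_add (hY r hr) (h.trans ?_))
    exact mul_le_mul_of_nonneg_left (geom_bound hκ0.le hκ1 k) hY0
  obtain ⟨ε, hε0, hε1, hε⟩ := S.low hn hbn hA R0 hR0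
  have he2 : nrm A e2 = 1 := by simp [nrm, e2]
  obtain ⟨δ, hδ, hδF⟩ := S.unif hA (R0 + 1) (half_pos hε0)
  -- choose K
  obtain ⟨K, hK1, hK2⟩ : ∃ K : ℕ, κ ^ (K + 1) ≤ 1 / 2 ∧ 2 * κ ^ (K + 1) * (R0 + 1) ≤ δ / 2 := by
    have h1 : Filter.Tendsto (fun K : ℕ => κ ^ (K + 1)) Filter.atTop (nhds 0) :=
      (tendsto_pow_atTop_nhds_zero_of_lt_one hκ0.le hκ1).comp (Filter.tendsto_add_atTop_nat 1)
    have h2 : Filter.Tendsto (fun K : ℕ => 2 * κ ^ (K + 1) * (R0 + 1)) Filter.atTop (nhds 0) := by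
      have := (h1.const_mul 2).mul_const (R0 + 1)
      simpa using this
    have a1 := h1.eventually (ge_mem_nhds (by norm_num : (0:ℝ) < 1 / 2))
    have a2 := h2.eventually (ge_mem_nhds (half_pos hδ))
    obtain ⟨K, h⟩ := (a1.and a2).exists
    exact ⟨K, h.1, h.2⟩
  set K' := K + 1 with hK'
  let q := p ^ K'
  have hq2 : 2 ≤ q := by
    calc 2 ≤ p := hp2
      _ ≤ p ^ K' := Nat.le_self_pow (by omega) p
  have hTU : ∀ v, (T ^ K') ((U ^ K') v) = v := Tm_Um_pow hb0 K'
  let g : V2 → ℂ := fun η => Fn b c m K' ((U ^ K') η)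
  let z : ℕ → V2 := fun r => if ε ≤ ‖F ((T ^ K') (σ r))‖ then 0 else e2
  have hz : ∀ r, z r ∈ Gam s := by
    intro r
    simp only [z]
    split_ifs
    · exact (Gam s).zero_mem
    · exact ⟨0, 1, by simp [e2], by simp [e2]⟩
  let x : ℕ → V2 := fun r => (T ^ K') (σ r) + z r
  have hx0 : x 0 = 0 := by
    simp only [x, z]
    rw [hσ, lamSeq_zero, map_zero, S.F0]
    simp [hε1]
  have hgper : ∀ η, ∀ γ ∈ Gam s, g (η + γ) = g η := by
    intro η γ hγ
    simp only [g, Fn]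
    refine Finset.prod_congr rfl fun k hk => ?_
    have hk' := Finset.mem_range.1 hk
    have e1 : ∀ v, (T ^ (k + 1)) ((U ^ K') v) = (U ^ (K' - (k + 1))) v := by
      intro v
      have : U ^ K' = U ^ (k + 1) * U ^ (K' - (k + 1)) := by
        rw [← pow_add]; congr 1; omega
      rw [this, Module.End.mul_apply]
      exact Tm_Um_pow hb0 _ _
    rw [← hT, e1, e1, map_add]
    exact S.per_Gam _ (Gam_pow hUΓ _ γ hγ)
  have hxsum : ∀ η, ∑ r ∈ Finset.range q, ‖g (η + x r)‖ ^ 2 = 1 := by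
    intro η
    rw [← htile1 K' ((U ^ K') η)]
    refine Finset.sum_congr rfl fun r _ => ?_
    simp only [x]
    rw [← add_assoc, hgper _ _ (hz r)]
    simp only [g]
    rw [map_add]
    have : (U ^ K') ((T ^ K') (σ r)) = σ r := Um_Tm_pow hb0 K' _
    rw [this]
    rfl
  have hNx : ∀ r < q, (U ^ K') (x r) ∈ Gam s := by
    intro r _
    simp only [x]
    rw [map_add]
    have : (U ^ K') ((T ^ K') (σ r)) = σ r := Um_Tm_pow hb0 K' _
    rw [this]
    exact (Gam s).add_mem (hσΓ r) (Gam_pow hUΓ _ _ (hz r))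
  have htile2 := tile g hq2 (U ^ K') (T ^ K') hTU (Gam s)
    (fun η γ hγ => by rw [hgper η γ hγ]) (Gam_pow hUΓ K') x hx0 hNx hxsum
  have hxR : ∀ r < q, nrm A (x r) ≤ R0 + 1 := by
    intro r hr
    refine (nrm_add hA _ _).trans (add_le_add (hσR K r hr) ?_)
    simp only [z]
    split_ifs
    · simp [nrm_zero]
    · exact he2.le
  have hxF : ∀ r < q, ε ≤ ‖F (x r)‖ := by
    intro r hr
    simp only [x, z]
    split_ifs with h
    · simpa using h
    · exact (hε _ (hσR K r hr)).resolve_left h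
  have hκK : ∀ v, nrm A ((T ^ K') v) ≤ κ ^ K' * nrm A v := nrm_pow T hκ0.le hκ K'
  have hκK0 : 0 < κ ^ K' := by positivity
  refine ⟨lamSeq q (U ^ K') x, hasSum_of_tile S.Fcont S.F0 S.Fle (T ^ K')
    (fun k ξ => ∏ l ∈ Finset.range k, g (((T ^ K') ^ (l + 1)) ξ)) ?_ ?_ hq2 _ htile2
    (half_pos hε0) ?_⟩
  · intro k v
    induction k with
    | zero => simp
    | succ k ih =>
      rw [ih, Finset.prod_range_succ, S.F_eq K' (((T ^ K') ^ k) v)]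
      have e1 : ((T ^ K') ^ (k + 1)) v = (T ^ K') (((T ^ K') ^ k) v) := by
        rw [pow_succ', Module.End.mul_apply]
      have e2 : (U ^ K') ((T ^ K') (((T ^ K') ^ k) v)) = ((T ^ K') ^ k) v := Um_Tm_pow hb0 K' _
      simp only [g]
      rw [e1, e2]
      ring
  · intro v
    have := (Tm_pow_tendsto S.hb c v).comp (Filter.tendsto_id.const_mul_atTop' (show 0 < K' by omega))
    refine this.congr fun k => ?_
    simp only [Function.comp, id, ← hT]
    rw [pow_mul]
  · intro ξ
    have h1 : Filter.Tendsto (fun k : ℕ => (κ ^ K') ^ k * nrm A ξ) Filter.atTop (nhds 0) := by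
      have := (tendsto_pow_atTop_nhds_zero_of_lt_one hκK0.le
        (lt_of_le_of_lt hK1 (by norm_num))).mul_const (nrm A ξ)
      simpa using this
    obtain ⟨k0, hk0⟩ := Filter.eventually_atTop.1 (h1.eventually (ge_mem_nhds (half_pos hδ)))
    refine ⟨k0 + 1, ?_⟩
    intro k hk i hi
    obtain ⟨k, rfl⟩ : ∃ k', k = k' + 1 := ⟨k - 1, by omega⟩
    obtain ⟨r, hr, hnear⟩ := lam_near hq2 (U ^ K') (T ^ K') hTU hA hκK0.le hκK x hx0 hxR k i hi
    have h2 : nrm A (((T ^ K') ^ (k + 1)) (ξ + lamSeq q (U ^ K') x i) - x r) ≤ δ := by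
      rw [map_add, add_sub_assoc]
      refine (nrm_add hA _ _).trans ?_
      have h3 := (nrm_pow (T ^ K') hκK0.le hκK (k + 1) ξ).trans (hk0 (k + 1) (by omega))
      have h4 : (R0 + 1) * ∑ l ∈ Finset.range k, (κ ^ K') ^ (l + 1) ≤ δ / 2 := by
        have h5 := geom_bound hκK0.le (lt_of_le_of_lt hK1 (by norm_num)) k
        have h6 : κ ^ K' / (1 - κ ^ K') ≤ 2 * κ ^ K' := by
          rw [div_le_iff₀ (by linarith)]
          nlinarith
        calc _ ≤ (R0 + 1) * (2 * κ ^ K') := by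
              apply mul_le_mul_of_nonneg_left (h5.trans h6); linarith
          _ ≤ δ / 2 := by linarith
      linarith
    have h3 := hδF _ _ (hxR r hr) h2
    have h4 := hxF r hr
    have h5 := norm_sub_norm_le (F (x r)) (F (((T ^ K') ^ (k + 1)) (ξ + lamSeq q (U ^ K') x i)))
    rw [norm_sub_rev] at h5
    linarith
end

/-- An orthogonal family satisfying the Parseval identity generically. -/
structure Fam (F : V2 → ℂ) {ι : Type} (l : ι → V2) : Prop where
  cnt : Countable ι
  orth : ∀ i j, i ≠ j → F (l i - l j) = 0
  par : ∃ Z : Set ℝ, Z.Countable ∧ ∀ ξ : V2, ξ 0 ∉ Z → HasSum (fun i => ‖F (ξ + l i)‖ ^ 2) 1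

section
variable {p : ℕ} {b c : ℝ} {a : Fin 2 → ℤ} {m F : V2 → ℂ}

lemma Sys.generic (S : Sys p b c a m F) : ∃ Z : Set ℝ, Z.Countable ∧ ∀ x : V2, x 0 ∉ Z →
    F x ≠ 0 ∧ ∀ k : ℕ, m ((Tm b c ^ k) x) ≠ 0 ∧ ‖m ((Tm b c ^ k) x)‖ < 1 := by
  obtain ⟨q, hq, h1, -⟩ := S.gen
  have hqR : (q : ℝ) ≠ 0 := by exact_mod_cast hq
  have hb0 := S.bpos.ne'
  have hp0 := S.ppos.ne'
  let Z0 : Set ℝ := Set.range (fun y : ℕ × ℤ => b ^ y.1 * y.2 / p)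
  let Z1 : Set ℝ := Set.range (fun y : ℕ × ℤ => b ^ y.1 * y.2 / q)
  refine ⟨Z0 ∪ Z1, (Set.countable_range _).union (Set.countable_range _), ?_⟩
  intro x hx
  have hk : ∀ k : ℕ, m ((Tm b c ^ k) x) ≠ 0 := by
    intro k h
    obtain ⟨w, j, -, -, hw⟩ := (S.zero' _).1 h
    apply hx
    left
    refine ⟨(k, w 0), ?_⟩
    have := hw 0
    rw [Tm_pow_zero', inv_pow] at this
    simp only
    rw [← this]
    field_simp
  refine ⟨?_, fun k => ⟨hk k, ?_⟩⟩
  · intro h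
    obtain ⟨k, -, h⟩ := (S.F_zero _).1 h
    exact hk k h
  · rcases h1 ((Tm b c ^ k) x) with h | ⟨N, hN⟩
    · exact h
    · exfalso
      apply hx
      right
      refine ⟨(k, N), ?_⟩
      rw [Tm_pow_zero', inv_pow] at hN
      simp only
      rw [← hN]
      field_simp

lemma exists_generic {ι : Type} [Countable ι] (l : ι → V2) {Z Z' : Set ℝ} (hZ : Z.Countable)
    (hZ' : Z'.Countable) : ∃ ξ : V2, ξ 0 ∉ Z ∧ ∀ i, (ξ + l i) 0 ∉ Z' := by
  have hc : (Z ∪ ⋃ i, (fun x => x - l i 0) '' Z').Countable :=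
    hZ.union (Set.countable_iUnion fun i => hZ'.image _)
  have hne : (Z ∪ ⋃ i, (fun x => x - l i 0) '' Z') ≠ Set.univ := by
    intro h
    rw [h] at hc
    exact Cardinal.not_countable_real hc
  obtain ⟨y, hy⟩ := (Set.ne_univ_iff_exists_notMem _).1 hne
  refine ⟨fun _ => y, fun h => hy (Or.inl h), fun i h => hy (Or.inr ?_)⟩
  refine Set.mem_iUnion.2 ⟨i, _, h, ?_⟩
  simp

lemma Fam.strict (S : Sys p b c a m F) {ι : Type} {l : ι → V2} (hl : Fam F l) (G H : V2 → ℂ)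
    (hGH : ∀ x, F x = G x * H x) {ZH : Set ℝ} (hZH : ZH.Countable)
    (hH : ∀ x : V2, x 0 ∉ ZH → ‖H x‖ < 1)
    (hG : ∀ (s : Finset ι) (ξ : V2), ∑ i ∈ s, ‖G (ξ + l i)‖ ^ 2 ≤ 1) : False := by
  have := hl.cnt
  obtain ⟨Z, hZ, hpar⟩ := hl.par
  obtain ⟨Zg, hZg, hgen⟩ := S.generic
  obtain ⟨ξ, hξ, hξi⟩ := exists_generic l hZ (hZg.union hZH)
  have hs := hpar ξ hξ
  have hlt : ∀ i, ‖F (ξ + l i)‖ ^ 2 < ‖G (ξ + l i)‖ ^ 2 := by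
    intro i
    have h1 := (hgen _ (fun h => hξi i (Or.inl h))).1
    have h2 := hH _ (fun h => hξi i (Or.inr h))
    have h3 := hGH (ξ + l i)
    have hG0 : 0 < ‖G (ξ + l i)‖ := by
      rw [norm_pos_iff]
      rintro h
      rw [h, zero_mul] at h3
      exact h1 h3
    apply pow_lt_pow_left₀ _ (norm_nonneg _) two_ne_zero
    rw [h3, norm_mul]
    exact mul_lt_of_lt_one_right hG0 h2
  have hsG : Summable (fun i => ‖G (ξ + l i)‖ ^ 2) :=
    summable_of_sum_le (fun _ => by positivity) (fun s => hG s ξ)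
  have hle : ∑' i, ‖G (ξ + l i)‖ ^ 2 ≤ 1 := Real.tsum_le_of_sum_le (fun _ => by positivity)
    (fun s => hG s ξ)
  rcases isEmpty_or_nonempty ι with h | ⟨⟨i⟩⟩
  · have := hs.tsum_eq
    simp at this
  · have := Summable.tsum_lt_tsum (fun i => (hlt i).le) (hlt i) hs.summable hsG
    rw [hs.tsum_eq] at this
    linarith

lemma Fam.levels_unbdd (S : Sys p b c a m F) {ι : Type} {l : ι → V2} (hl : Fam F l) (K : ℕ) :
    ∃ i j, i ≠ j ∧ ∀ k, 1 ≤ k → k ≤ K → m ((Tm b c ^ k) (l i - l j)) ≠ 0 := by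
  by_contra hcon
  push Not at hcon
  obtain ⟨Zg, hZg, hgen⟩ := S.generic
  refine hl.strict S (Fn b c m K) (fun x => F ((Tm b c ^ K) x)) (S.F_eq K) hZg ?_ ?_
  · intro x hx
    have := ((hgen x hx).2 (K + 1)).2
    rw [S.Frec, norm_mul, ← Module.End.mul_apply, ← pow_succ']
    calc _ ≤ ‖m ((Tm b c ^ (K + 1)) x)‖ * 1 :=
          mul_le_mul_of_nonneg_left (S.Fle _) (norm_nonneg _)
      _ < 1 := by rwa [mul_one]
  · intro s ξ
    refine (S.Fn_FT K).bessel l s (fun i _ j _ hij => ?_) ξ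
    rw [Sys.Fn_zero]
    exact hcon i j hij

lemma Fam.level_one (S : Sys p b c a m F) {ι : Type} {l : ι → V2} (hl : Fam F l) :
    ∃ i j, i ≠ j ∧ m (Tm b c (l i - l j)) = 0 ∧ F (Tm b c (l i - l j)) ≠ 0 := by
  by_contra hcon
  push Not at hcon
  obtain ⟨Zg, hZg, hgen⟩ := S.generic
  refine hl.strict S (fun x => F (Tm b c x)) (fun x => m (Tm b c x))
    (fun x => by rw [S.Frec, mul_comm]) hZg ?_ ?_
  · intro x hx
    simpa using ((hgen x hx).2 1).2
  · intro s ξ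
    refine (S.FFT.comp (Tm b c)).bessel l s (fun i _ j _ hij => ?_) ξ
    have h1 := hl.orth i j hij
    rw [S.Frec] at h1
    rcases mul_eq_zero.1 h1 with h | h
    · exact hcon i j hij h
    · exact h

end

lemma caseA_int {p : ℕ} (hp : p.Prime) {b : ℝ} (hb : 1 < b)
    (hR : (p : ℝ)⁻¹ ∈ Algebra.adjoin ℤ {b}) (w u v : ℤ) (N i j : ℕ) (hi : i < N) (hj : j < N)
    (h : b ^ N * w = b ^ i * u + b ^ j * v) : (p : ℤ) ∣ w := by
  have hp0 : (p : ℝ) ≠ 0 := by exact_mod_cast hp.ne_zero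
  -- `w * b` is integral
  have hwbInt : IsIntegral ℤ ((w : ℝ) * b) := by
    let P : Polynomial ℤ := Polynomial.X ^ N - (Polynomial.C (u * w ^ (N - 1 - i)) * Polynomial.X ^ i
      + Polynomial.C (v * w ^ (N - 1 - j)) * Polynomial.X ^ j)
    refine ⟨P, ?_, ?_⟩
    · apply Polynomial.monic_X_pow_sub
      refine lt_of_le_of_lt (Polynomial.degree_add_le _ _) (max_lt ?_ ?_)
      · exact lt_of_le_of_lt (Polynomial.degree_C_mul_X_pow_le _ _) (by exact_mod_cast hi)
      · exact lt_of_le_of_lt (Polynomial.degree_C_mul_X_pow_le _ _) (by exact_mod_cast hj)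
    · simp only [P, Polynomial.eval₂_sub, Polynomial.eval₂_add, Polynomial.eval₂_mul,
        Polynomial.eval₂_X_pow, Polynomial.eval₂_C]
      simp only [algebraMap_int_eq, eq_intCast, Int.cast_mul, Int.cast_pow, mul_pow]
      have e1 : (w : ℝ) ^ (N - 1 - i) * w ^ i = w ^ (N - 1) := by
        rw [← pow_add]; congr 1; omega
      have e2 : (w : ℝ) ^ (N - 1 - j) * w ^ j = w ^ (N - 1) := by
        rw [← pow_add]; congr 1; omega
      have e3 : (w : ℝ) ^ N = w ^ (N - 1) * w := by
        rw [← pow_succ]; congr 1; omega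
      rw [e3]
      linear_combination (w : ℝ) ^ (N - 1) * h - u * b ^ i * e1 - v * b ^ j * e2
  have key : ∀ x ∈ Algebra.adjoin ℤ {b}, ∃ d : ℕ, IsIntegral ℤ ((w : ℝ) ^ d * x) := by
    intro x hx
    have hw : IsIntegral ℤ (w : ℝ) := by
      have := isIntegral_algebraMap (R := ℤ) (A := ℝ) (x := w)
      simpa using this
    induction hx using Algebra.adjoin_induction with
    | mem x hx =>
      rw [Set.mem_singleton_iff] at hx
      subst hx
      exact ⟨1, by simpa using hwbInt⟩
    | algebraMap r => exact ⟨0, by simpa using isIntegral_algebraMap (R := ℤ) (A := ℝ) (x := r)⟩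
    | add x y _ _ h1 h2 =>
      obtain ⟨d, h1⟩ := h1
      obtain ⟨d', h2⟩ := h2
      refine ⟨d + d', ?_⟩
      have := ((hw.pow d').mul h1).add ((hw.pow d).mul h2)
      rw [show (w : ℝ) ^ (d + d') * (x + y) = w ^ d' * (w ^ d * x) + w ^ d * (w ^ d' * y) by ring]
      exact this
    | mul x y _ _ h1 h2 =>
      obtain ⟨d, h1⟩ := h1
      obtain ⟨d', h2⟩ := h2
      refine ⟨d + d', ?_⟩
      have := h1.mul h2
      rw [show (w : ℝ) ^ (d + d') * (x * y) = w ^ d * x * (w ^ d' * y) by ring]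
      exact this
  obtain ⟨d, hd⟩ := key _ hR
  have hd' : IsIntegral ℤ ((w : ℚ) ^ d * (p : ℚ)⁻¹) := by
    rw [← isIntegral_algebraMap_iff (B := ℝ) (algebraMap ℚ ℝ).injective]
    simpa using hd
  obtain ⟨z, hz⟩ := IsIntegrallyClosed.isIntegral_iff.1 hd'
  have hz' : w ^ d = p * z := by
    have hp0' : (p : ℚ) ≠ 0 := by exact_mod_cast hp.ne_zero
    have : (w : ℚ) ^ d = p * z := by
      simp only [algebraMap_int_eq, eq_intCast] at hz
      rw [hz]
      field_simp
    exact_mod_cast this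
  exact (Nat.prime_iff_prime_int.1 hp).dvd_of_dvd_pow ⟨z, hz'⟩

lemma caseA {p : ℕ} (hp : p.Prime) {b : ℝ} (hb : 1 < b)
    (hR : (p : ℝ)⁻¹ ∈ Algebra.adjoin ℤ {b}) {ι : Type} (α : ι → ℝ)
    (h : ∀ i j, i ≠ j → ∃ k : ℕ, 1 ≤ k ∧ ∃ w : ℤ, ¬ (p : ℤ) ∣ w ∧ α i - α j = b ^ k * w)
    (hunb : ∀ K : ℕ, ∃ i j, i ≠ j ∧ ∃ k : ℕ, K < k ∧ ∃ w : ℤ, ¬ (p : ℤ) ∣ w ∧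
      α i - α j = b ^ k * w) : False := by
  have hb0 : 0 < b := by linarith
  -- ultrametric inequality
  have ultra : ∀ i j e : ι, ∀ n n1 n2 : ℕ, ∀ w w1 w2 : ℤ, ¬ (p : ℤ) ∣ w →
      α i - α j = b ^ n * w → α i - α e = b ^ n1 * w1 → α j - α e = b ^ n2 * w2 →
      n ≤ max n1 n2 := by
    intro i j e n n1 n2 w w1 w2 hw h0 h1 h2
    by_contra hlt
    push Not at hlt
    apply hw
    apply caseA_int hp hb hR w w1 (-w2) n n1 n2 (lt_of_le_of_lt (le_max_left _ _) hlt)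
      (lt_of_le_of_lt (le_max_right _ _) hlt)
    push_cast
    linear_combination h1 - h2 - h0
  obtain ⟨i1, i0, hne, k1, -, w1, hw1, h1⟩ := hunb 0
  obtain ⟨n, hn⟩ := pow_unbounded_of_one_lt (|(w1 : ℝ)|) hb
  -- an element at a large level from `i0`
  obtain ⟨j, k, hk, v, hv, hjk⟩ : ∃ j : ι, ∃ k : ℕ, k1 + n < k ∧ ∃ v : ℤ, ¬ (p : ℤ) ∣ v ∧
      α j - α i0 = b ^ k * v := by
    obtain ⟨i, j, hij, k, hk, w, hw, e⟩ := hunb (k1 + n)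
    by_cases hi : i = i0
    · subst hi
      exact ⟨j, k, hk, -w, by rwa [dvd_neg], by push_cast; linear_combination -e⟩
    by_cases hj : j = i0
    · subst hj
      exact ⟨i, k, hk, w, hw, e⟩
    obtain ⟨k2, -, w2, hw2, e2⟩ := h i i0 hi
    obtain ⟨k3, -, w3, hw3, e3⟩ := h j i0 hj
    have := ultra i j i0 k k2 k3 w w2 w3 hw e e2 e3
    rcases le_max_iff.1 this with h' | h'
    · exact ⟨i, k2, by omega, w2, hw2, e2⟩
    · exact ⟨j, k3, by omega, w3, hw3, e3⟩
  have hw1' : w1 ≠ 0 := fun h => hw1 (h ▸ dvd_zero _)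
  -- uniqueness of level
  have hji1 : j ≠ i1 := by
    rintro rfl
    have := ultra j i0 i0 k k1 0 v w1 0 hv hjk h1 (by simp)
    have := le_max_iff.1 this
    omega
  obtain ⟨n', -, w, hw, e⟩ := h j i1 hji1
  have a1 := ultra j i1 i0 n' k k1 w v w1 hw e hjk h1
  have a2 := ultra j i0 i1 k n' k1 v w (-w1) hv hjk e (by push_cast; linear_combination -h1)
  have hnk : n' = k := by
    rcases le_max_iff.1 a1 with h' | h' <;> rcases le_max_iff.1 a2 with h'' | h'' <;> omega
  subst hnk
  have e3 : b ^ k1 * w1 = b ^ n' * (v - w) := by linear_combination hjk - h1 - e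
  have e4 : (w1 : ℝ) = b ^ (n' - k1) * ((v - w : ℤ) : ℝ) := by
    apply mul_left_cancel₀ (pow_pos hb0 k1).ne'
    rw [e3, ← mul_assoc, ← pow_add]
    push_cast
    congr 2
    omega
  have hvw : v - w ≠ 0 := by
    intro h0
    rw [h0] at e4
    simp at e4
    exact hw1' e4
  have h5 : (1 : ℝ) ≤ |((v - w : ℤ) : ℝ)| := by
    rw [← Int.cast_abs]
    exact_mod_cast Int.one_le_abs hvw
  have h6 : b ^ n ≤ |(w1 : ℝ)| := by
    rw [e4, abs_mul, abs_of_pos (pow_pos hb0 _)]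
    calc b ^ n ≤ b ^ (n' - k1) := pow_le_pow_right₀ hb.le (by omega)
      _ ≤ _ := le_mul_of_one_le_right (pow_pos hb0 _).le h5
  linarith

lemma star {p : ℕ} (hp : p.Prime) {b : ℝ} (hb : 1 < b) {ι : Type} [Infinite ι] (α : ι → ℝ)
    (h : ∀ i j, i ≠ j → ∃ k : ℕ, 1 ≤ k ∧ ∃ w : ℤ, ¬ (p : ℤ) ∣ w ∧ α i - α j = b ^ k * w)
    (hunb : ∀ K : ℕ, ∃ i j, i ≠ j ∧ ∃ k : ℕ, K < k ∧ ∃ w : ℤ, ¬ (p : ℤ) ∣ w ∧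
      α i - α j = b ^ k * w)
    (w u v : ℤ) (i j : ℕ) (hi : 1 ≤ i) (hj : 1 ≤ j) (e : (w : ℝ) = b ^ i * u + b ^ j * v) :
    (p : ℤ) ∣ w := by
  by_cases hR : (p : ℝ)⁻¹ ∈ Algebra.adjoin ℤ {b}
  · exact (caseA hp hb hR α h hunb).elim
  have hp0 : (p : ℝ) ≠ 0 := by exact_mod_cast hp.ne_zero
  set R := Algebra.adjoin ℤ {b} with hRdef
  have hbR : b ∈ R := Algebra.self_mem_adjoin_singleton ℤ b
  let bR : R := ⟨b, hbR⟩
  have hnu : ¬ IsUnit ((p : ℕ) : R) := by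
    intro hu
    obtain ⟨y, hy⟩ := hu.exists_right_inv
    apply hR
    have : (p : ℝ) * (y : ℝ) = 1 := by
      have := congrArg (fun z : R => (z : ℝ)) hy
      simpa using this
    rw [inv_eq_of_mul_eq_one_right this]
    exact y.2
  obtain ⟨M, hM, hpM⟩ := exists_max_ideal_of_mem_nonunits hnu
  let _ : Field (R ⧸ M) := Ideal.Quotient.field M
  let φ : R →+* R ⧸ M := Ideal.Quotient.mk M
  have hφp : ((p : ℕ) : R ⧸ M) = 0 := by
    have : φ (p : R) = 0 := Ideal.Quotient.eq_zero_iff_mem.2 hpM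
    simpa using this
  have hφw : ∀ w : ℤ, ¬ (p : ℤ) ∣ w → ((w : ℤ) : R ⧸ M) ≠ 0 := by
    intro w hw h0
    have hc : IsCoprime (p : ℤ) w := (Prime.coprime_iff_not_dvd (Nat.prime_iff_prime_int.1 hp)).2 hw
    obtain ⟨x, y, hxy⟩ := hc
    have := congrArg (fun z : ℤ => (z : R ⧸ M)) hxy
    simp only [Int.cast_add, Int.cast_mul, Int.cast_natCast, hφp, h0, mul_zero, add_zero,
      Int.cast_one] at this
    exact zero_ne_one this
  have hfin : Finite (R ⧸ M) := by
    have hft : Algebra.FiniteType ℤ R := by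
      rw [← Subalgebra.fg_iff_finiteType]
      exact Subalgebra.fg_adjoin_finset {b} |> fun h => by simpa using h
    have hft2 : Algebra.FiniteType ℤ (R ⧸ M) := inferInstance
    have hfact : Fact p.Prime := ⟨hp⟩
    have hchar : CharP (R ⧸ M) p := by
      refine ⟨fun n => ⟨fun hn => ?_, ?_⟩⟩
      · by_contra hd
        exact hφw n (by exact_mod_cast hd) (by simpa using hn)
      · rintro ⟨e, rfl⟩
        rw [Nat.cast_mul, hφp, zero_mul]
    let _ : Algebra (ZMod p) (R ⧸ M) := ZMod.algebra (R ⧸ M) p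
    have hft3 : Algebra.FiniteType (ZMod p) (R ⧸ M) :=
      Algebra.FiniteType.of_restrictScalars_finiteType ℤ (ZMod p) (R ⧸ M)
    have hmf : Module.Finite (ZMod p) (R ⧸ M) :=
      finite_of_finite_type_of_isJacobsonRing (ZMod p) (R ⧸ M)
    exact Module.finite_of_finite (ZMod p)
  by_cases hb1 : φ bR = 0
  · by_contra hw
    apply hφw w hw
    have eR : ((w : ℤ) : R) = bR ^ i * u + bR ^ j * v := by
      apply Subtype.ext
      simp only [bR]
      push_cast
      exact e
    have := congrArg φ eR
    rw [map_add, map_mul, map_mul, map_pow, map_pow, hb1, zero_pow (by omega), zero_pow (by omega),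
      zero_mul, zero_mul, add_zero] at this
    simpa using this
  · exfalso
    obtain ⟨i0⟩ : Nonempty ι := inferInstance
    have hmem : ∀ i, α i - α i0 ∈ R := by
      intro i
      by_cases hi0 : i = i0
      · subst hi0; simp
      · obtain ⟨k, -, w, -, e⟩ := h i i0 hi0
        rw [e]
        exact R.mul_mem (R.pow_mem hbR k) (by simp)
    let f : ι → R ⧸ M := fun i => φ ⟨α i - α i0, hmem i⟩
    have hf : Function.Injective f := by
      intro i j hij
      by_contra hne
      obtain ⟨k, -, w, hw, e⟩ := h i j hne
      have eR : (⟨α i - α i0, hmem i⟩ : R) - ⟨α j - α i0, hmem j⟩ = bR ^ k * ((w : ℤ) : R) := by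
        apply Subtype.ext
        simp only [bR]
        push_cast
        rw [← e]
        ring
      have := congrArg φ eR
      rw [map_sub, map_mul, map_pow] at this
      have h0 : φ ⟨α i - α i0, hmem i⟩ - φ ⟨α j - α i0, hmem j⟩ = 0 := sub_eq_zero.2 hij
      rw [h0] at this
      rcases mul_eq_zero.1 this.symm with h1 | h1
      · exact hb1 (eq_zero_of_pow_eq_zero h1)
      · exact hφw w hw (by simpa using h1)
    exact not_injective_infinite_finite f hf

section
variable {p : ℕ} {b c : ℝ} {a : Fin 2 → ℤ} {m F : V2 → ℂ}

lemma Sys.m_neg (S : Sys p b c a m F) {x : V2} (h : m x = 0) : m (-x) = 0 := by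
  obtain ⟨w, j, hj, hw, e⟩ := (S.zero' _).1 h
  refine (S.zero' _).2 ⟨-w, -j, by rwa [dvd_neg], fun i => ?_, fun i => ?_⟩
  · have := (hw i).neg_right
    rw [show (-w) i - -j * a i = -(w i - j * a i) by simp; ring]
    exact this
  · have := e i
    simp only [Pi.neg_apply]
    push_cast
    linarith

lemma Sys.lev_eq (S : Sys p b c a m F) {x : V2} {k : ℕ} (h : m ((Tm b c ^ k) x) = 0) :
    ∃ w : ℤ, ¬ (p : ℤ) ∣ w ∧ p * x 0 = b ^ k * w := by
  obtain ⟨w, j, hj, hw, e⟩ := (S.zero' _).1 h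
  refine ⟨w 0, S.not_dvd hj (hw 0), ?_⟩
  rw [← e 0, Tm_pow_zero', inv_pow]
  have := S.bpos.ne'
  field_simp

lemma Fam.infinite (S : Sys p b c a m F) {ι : Type} {l : ι → V2} (hl : Fam F l) : Infinite ι := by
  by_contra hfin
  rw [not_infinite_iff_finite] at hfin
  have h : ∀ y : ι × ι, ∃ k, y.1 ≠ y.2 → 1 ≤ k ∧ m ((Tm b c ^ k) (l y.1 - l y.2)) = 0 := by
    intro y
    by_cases hy : y.1 = y.2
    · exact ⟨0, fun h => absurd hy h⟩
    · obtain ⟨k, hk⟩ := (S.F_zero _).1 (hl.orth _ _ hy)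
      exact ⟨k, fun _ => hk⟩
  choose k hk using h
  obtain ⟨K, hK⟩ := (Set.finite_range k).bddAbove
  obtain ⟨i, j, hij, h⟩ := hl.levels_unbdd S K
  exact h _ (hk (i, j) hij).1 (hK ⟨(i, j), rfl⟩) (hk (i, j) hij).2

lemma Fam.star (S : Sys p b c a m F) {ι : Type} {l : ι → V2} (hl : Fam F l)
    (w u v : ℤ) (i j : ℕ) (hi : 1 ≤ i) (hj : 1 ≤ j) (e : (w : ℝ) = b ^ i * u + b ^ j * v) :
    (p : ℤ) ∣ w := by
  have := hl.infinite S
  refine _root_.star S.hp S.hb (fun i => p * l i 0) ?_ ?_ w u v i j hi hj e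
  · intro i j hij
    obtain ⟨k, hk, h⟩ := (S.F_zero _).1 (hl.orth _ _ hij)
    obtain ⟨w, hw, e⟩ := S.lev_eq h
    refine ⟨k, hk, w, hw, ?_⟩
    rw [← e, Pi.sub_apply]
    ring
  · intro K
    obtain ⟨i, j, hij, h'⟩ := hl.levels_unbdd S K
    obtain ⟨k, hk, h⟩ := (S.F_zero _).1 (hl.orth _ _ hij)
    obtain ⟨w, hw, e⟩ := S.lev_eq h
    refine ⟨i, j, hij, k, ?_, w, hw, ?_⟩
    · by_contra hcon
      exact h' k hk (by omega) h
    · rw [← e, Pi.sub_apply]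
      ring

lemma Fam.tri (S : Sys p b c a m F) {ι : Type} {l : ι → V2} (hl : Fam F l) (i x y : ι)
    (h : m (Tm b c (l x - l y)) = 0) :
    m (Tm b c (l i - l x)) = 0 ∨ m (Tm b c (l i - l y)) = 0 := by
  by_contra hcon
  push Not at hcon
  obtain ⟨h1, h2⟩ := hcon
  have hix : i ≠ x := by
    rintro rfl
    exact h2 h
  have hiy : i ≠ y := by
    rintro rfl
    apply h1
    have := S.m_neg h
    rwa [← map_neg, neg_sub] at this
  obtain ⟨k1, hk1, e1⟩ := (S.F_zero _).1 (hl.orth _ _ hix)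
  obtain ⟨k2, hk2, e2⟩ := (S.F_zero _).1 (hl.orth _ _ hiy)
  have hk1' : k1 ≠ 1 := by
    rintro rfl
    rw [pow_one] at e1
    exact h1 e1
  have hk2' : k2 ≠ 1 := by
    rintro rfl
    rw [pow_one] at e2
    exact h2 e2
  obtain ⟨w1, -, e1⟩ := S.lev_eq e1
  obtain ⟨w2, -, e2⟩ := S.lev_eq e2
  obtain ⟨w, hw, e⟩ := S.lev_eq (k := 1) (by rwa [pow_one])
  apply hw
  refine hl.star S w (-w1) w2 (k1 - 1) (k2 - 1) (by omega) (by omega) ?_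
  apply mul_left_cancel₀ S.bpos.ne'
  obtain ⟨k1, rfl⟩ : ∃ n, k1 = n + 1 := ⟨k1 - 1, by omega⟩
  obtain ⟨k2, rfl⟩ : ∃ n, k2 = n + 1 := ⟨k2 - 1, by omega⟩
  simp only [Pi.sub_apply, pow_one, Nat.add_sub_cancel] at *
  push_cast
  rw [pow_succ] at e1 e2
  linear_combination e2 - e1 - e

lemma Fam.dich (S : Sys p b c a m F) {ι : Type} {l : ι → V2} (hl : Fam F l) (i j : ι) (hij : i ≠ j) :
    m (Tm b c (l i - l j)) = 0 ∨ ∃ k, Tm b c (l i - l j) = intV k := by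
  by_cases hm : m (Tm b c (l i - l j)) = 0
  · exact Or.inl hm
  right
  obtain ⟨x, y, -, hxy, -⟩ := hl.level_one S
  have he : ∃ e, m (Tm b c (l i - l e)) = 0 := by
    rcases hl.tri S i x y hxy with h | h
    exacts [⟨_, h⟩, ⟨_, h⟩]
  obtain ⟨e, he⟩ := he
  have hje : m (Tm b c (l j - l e)) = 0 := by
    rcases hl.tri S j i e he with h | h
    · exfalso
      apply hm
      have := S.m_neg h
      rwa [← map_neg, neg_sub] at this
    · exact h
  obtain ⟨k, hk1, hk⟩ := (S.F_zero _).1 (hl.orth _ _ hij)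
  have hk1' : k ≠ 1 := by
    rintro rfl
    rw [pow_one] at hk
    exact hm hk
  obtain ⟨w0, -, e0⟩ := S.lev_eq hk
  obtain ⟨w1, j1, hj1, hw1, e1⟩ := (S.zero' _).1 he
  obtain ⟨w2, j2, hj2, hw2, e2⟩ := (S.zero' _).1 hje
  have hz : ∀ t, (p : ℝ) * Tm b c (l i - l j) t = ((w1 t - w2 t : ℤ) : ℝ) := by
    intro t
    push_cast
    rw [← e1, ← e2, ← mul_sub, ← Pi.sub_apply, ← map_sub]
    congr 3
    abel_nf
  have hd0 : (p : ℤ) ∣ w1 0 - w2 0 := by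
    refine hl.star S _ w0 0 (k - 1) 1 (by omega) le_rfl ?_
    rw [← hz, Tm_zero']
    obtain ⟨k, rfl⟩ : ∃ n, k = n + 1 := ⟨k - 1, by omega⟩
    have := S.bpos.ne'
    rw [Nat.add_sub_cancel, mul_left_comm, e0, pow_succ]
    field_simp
    simp
  have hdj : (p : ℤ) ∣ j1 - j2 := by
    have h1 : (p : ℤ) ∣ (j1 - j2) * a 0 := by
      have := (dvd_sub hd0 (hw1 0)).add (hw2 0)
      rw [show (j1 - j2) * a 0 = (w1 0 - w2 0) - (w1 0 - j1 * a 0) + (w2 0 - j2 * a 0) by ring]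
      exact this
    exact (S.pint.dvd_or_dvd h1).resolve_right (S.ha 0)
  have hd : ∀ t, (p : ℤ) ∣ w1 t - w2 t := by
    intro t
    have := ((hdj.mul_right (a t)).add (hw1 t)).sub (hw2 t)
    rw [show w1 t - w2 t = (j1 - j2) * a t + (w1 t - j1 * a t) - (w2 t - j2 * a t) by ring]
    exact this
  choose z hz' using hd
  refine ⟨z, ?_⟩
  ext t
  have := hz t
  rw [hz'] at this
  push_cast at this
  exact mul_left_cancel₀ S.ppos.ne' this

/-- the first coordinates of differences lie in `(b/p) ℤ` -/
lemma Fam.diff0 (S : Sys p b c a m F) {ι : Type} {l : ι → V2} (hl : Fam F l) (i j : ι) :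
    ∃ z : ℤ, p * (l i 0 - l j 0) = b * z := by
  have hb := S.bpos.ne'
  by_cases hij : i = j
  · subst hij
    exact ⟨0, by simp⟩
  rcases hl.dich S i j hij with h | ⟨k, hk⟩
  · obtain ⟨w, -, e⟩ := S.lev_eq (k := 1) (by rwa [pow_one])
    exact ⟨w, by simpa using e⟩
  · have := congrFun hk 0
    rw [Tm_zero'] at this
    simp only [intV, Pi.sub_apply] at this
    refine ⟨p * k 0, ?_⟩
    push_cast
    rw [← this]
    field_simp

lemma Fam.cls (S : Sys p b c a m F) {ι : Type} {l : ι → V2} (hl : Fam F l) (i j : ι) :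
    ∃ r : Fin p, ∃ k, Tm b c (l i - l j) = jv p a r + intV k := by
  have hp := S.hp.pos
  have h0 : jv p a 0 = 0 := by ext; simp [jv]
  by_cases hij : i = j
  · subst hij
    refine ⟨⟨0, hp⟩, 0, ?_⟩
    simp only [h0]
    ext; simp [intV]
  rcases hl.dich S i j hij with h | ⟨k, hk⟩
  · obtain ⟨r, h1, h2, k, e⟩ := (S.zero _).1 h
    exact ⟨⟨r, by omega⟩, k, e⟩
  · refine ⟨⟨0, hp⟩, k, ?_⟩
    simp only [h0, zero_add, hk]

lemma Sys.m0 (S : Sys p b c a m F) : m 0 ≠ 0 := by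
  intro h
  have := S.Frec 0
  rw [map_zero, h, S.F0] at this
  simp at this

lemma Fam.descend (S : Sys p b c a m F) {ι : Type} {l : ι → V2} (hl : Fam F l) :
    ∃ C : Set ι, (∀ i ∈ C, ∀ j ∈ C, ∃ k, Tm b c (l i - l j) = intV k) ∧
      Fam F (fun i : C => Tm b c (l i)) := by
  have := hl.infinite S
  obtain ⟨i0⟩ : Nonempty ι := inferInstance
  choose r k hr using fun i => hl.cls S i i0
  have hb := S.bpos.ne'
  have hcnt := hl.cnt
  have hsame : ∀ i j, r i = r j → Tm b c (l i - l j) = intV (k i - k j) := by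
    intro i j h
    have : l i - l j = (l i - l i0) - (l j - l i0) := by abel
    rw [this, map_sub, hr, hr, h, intV_sub]
    abel
  have horth : ∀ i j, i ≠ j → r i = r j → F (Tm b c (l i) - Tm b c (l j)) = 0 := by
    intro i j hij h
    have h1 := hl.orth i j hij
    rw [S.Frec] at h1
    rw [← map_sub]
    rcases mul_eq_zero.1 h1 with h2 | h2
    · rw [hsame i j h, ← zero_add (intV _), S.per] at h2
      exact absurd h2 S.m0
    · exact h2
  let r0 : Fin p := ⟨0, S.hp.pos⟩
  refine ⟨{i | r i = r0}, ?_, ?_, ?_, ?_⟩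
  · intro i hi j hj
    exact ⟨_, hsame i j (by rw [show r i = r0 from hi, show r j = r0 from hj])⟩
  · infer_instance
  · intro i j hij
    refine horth i j (fun h => hij (Subtype.ext h)) ?_
    rw [show r i = r0 from i.2, show r j = r0 from j.2]
  obtain ⟨Z, hZ, hpar⟩ := hl.par
  obtain ⟨Zg, hZg, hgen⟩ := S.generic
  refine ⟨(fun z => b * z) ⁻¹' Z ∪ (fun z => z + Tm b c (l i0) 0) ⁻¹' Zg,
    (hZ.preimage (mul_right_injective₀ hb)).union (hZg.preimage (add_left_injective _)), ?_⟩
  intro ξ hξ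
  have hbes : ∀ s : Finset ι, ∀ r1, (∀ i ∈ s, r i = r1) →
      ∑ i ∈ s, ‖F (ξ + Tm b c (l i))‖ ^ 2 ≤ 1 := by
    intro s r1 hs
    refine S.FFT.bessel (fun i => Tm b c (l i)) s (fun i hi j hj hij => ?_) ξ
    exact horth i j hij (by rw [hs i hi, hs j hj])
  have hbesC : ∀ s : Finset {i | r i = r0}, ∑ i ∈ s, ‖F (ξ + Tm b c (l i))‖ ^ 2 ≤ 1 := by
    intro s
    have := hbes (s.map (Function.Embedding.subtype _)) r0 (by
      intro i hi
      simp only [Finset.mem_map] at hi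
      obtain ⟨x, -, rfl⟩ := hi
      exact x.2)
    rw [Finset.sum_map] at this
    exact this
  have hsum : Summable (fun i : {i | r i = r0} => ‖F (ξ + Tm b c (l i))‖ ^ 2) :=
    summable_of_sum_le (fun _ => by positivity) hbesC
  set A := ∑' i : {i | r i = r0}, ‖F (ξ + Tm b c (l i))‖ ^ 2 with hA
  have hA1 : A ≤ 1 := Real.tsum_le_of_sum_le (fun _ => by positivity) hbesC
  suffices hA2 : ¬ A < 1 by
    have : A = 1 := le_antisymm hA1 (not_lt.1 hA2)
    rw [← this]
    exact hsum.hasSum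
  intro hA2
  set η := ξ + Tm b c (l i0) with hη
  have hmη : m η ≠ 0 := by
    have := ((hgen η (fun h => hξ (Or.inr h))).2 0).1
    simpa using this
  have hF := hpar (Um b c ξ) (fun h => hξ (Or.inl (by simpa [Um_zero'] using h)))
  have hterm : ∀ i, ‖F (Um b c ξ + l i)‖ ^ 2
      = ‖m (η + jv p a (r i))‖ ^ 2 * ‖F (ξ + Tm b c (l i))‖ ^ 2 := by
    intro i
    have h1 : Tm b c (Um b c ξ + l i) = ξ + Tm b c (l i) := by rw [map_add, Tm_Um hb]
    have h2 : ξ + Tm b c (l i) = η + jv p a (r i) + intV (k i) := by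
      have := hr i
      rw [map_sub] at this
      rw [hη, add_assoc _ (jv p a (r i)), ← this]
      abel
    rw [S.Frec, h1, norm_mul, mul_pow]
    congr 2
    rw [h2, S.per]
  have hfin : ∀ s : Finset ι, ∑ i ∈ s, ‖F (Um b c ξ + l i)‖ ^ 2 ≤ 1 - ‖m η‖ ^ 2 * (1 - A) := by
    intro s
    have h0 : jv p a (r0 : Fin p) = 0 := by ext; simp [jv, r0]
    have hhad := S.had η
    rw [← Finset.add_sum_erase _ _ (Finset.mem_univ r0)] at hhad
    rw [← Finset.sum_fiberwise s r, ← Finset.add_sum_erase _ _ (Finset.mem_univ r0)]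
    have e1 : ∑ i ∈ s with r i = r0, ‖F (Um b c ξ + l i)‖ ^ 2 ≤ ‖m η‖ ^ 2 * A := by
      have : ∑ i ∈ s with r i = r0, ‖F (Um b c ξ + l i)‖ ^ 2
          = ‖m η‖ ^ 2 * ∑ i ∈ s with r i = r0, ‖F (ξ + Tm b c (l i))‖ ^ 2 := by
        rw [Finset.mul_sum]
        refine Finset.sum_congr rfl (fun i hi => ?_)
        rw [hterm, (Finset.mem_filter.1 hi).2, h0, add_zero]
      rw [this]
      refine mul_le_mul_of_nonneg_left ?_ (by positivity)
      have e := hsum.sum_le_tsum (s.subtype (fun i => i ∈ {i | r i = r0})) (fun _ _ => by positivity)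
      rw [Finset.sum_subtype_eq_sum_filter (f := fun i => ‖F (ξ + Tm b c (l i))‖ ^ 2)] at e
      exact e
    have e2 : ∀ r1 : Fin p, ∑ i ∈ s with r i = r1, ‖F (Um b c ξ + l i)‖ ^ 2
        ≤ ‖m (η + jv p a r1)‖ ^ 2 := by
      intro r1
      have : ∑ i ∈ s with r i = r1, ‖F (Um b c ξ + l i)‖ ^ 2
          = ‖m (η + jv p a r1)‖ ^ 2 * ∑ i ∈ s with r i = r1, ‖F (ξ + Tm b c (l i))‖ ^ 2 := by
        rw [Finset.mul_sum]
        refine Finset.sum_congr rfl (fun i hi => ?_)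
        rw [hterm, (Finset.mem_filter.1 hi).2]
      rw [this]
      refine mul_le_of_le_one_right (by positivity) (hbes _ r1 (fun i hi => ?_))
      exact (Finset.mem_filter.1 hi).2
    have e3 := Finset.sum_le_sum (fun r1 (_ : r1 ∈ Finset.univ.erase r0) => e2 r1)
    rw [h0, add_zero] at hhad
    linarith
  have h1 : (1 : ℝ) ≤ 1 - ‖m η‖ ^ 2 * (1 - A) :=
    hasSum_le_of_sum_le hF hfin
  have h2 : 0 < ‖m η‖ ^ 2 * (1 - A) := by
    have := norm_pos_iff.2 hmη
    have : 0 < 1 - A := by linarith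
    positivity
  linarith

lemma Fam.rat (S : Sys p b c a m F) {ι : Type} {l : ι → V2} (hl : Fam F l) :
    ∃ w0 k0 d : ℤ, ¬ (p : ℤ) ∣ w0 ∧ b * w0 = p * k0 ∧ c * w0 ^ 2 = p * d := by
  obtain ⟨C, hC, hlC⟩ := hl.descend S
  obtain ⟨i, j, hij, hm, -⟩ := hlC.level_one S
  obtain ⟨k, hk⟩ := hC i i.2 j j.2
  rw [map_sub] at hk
  rw [hk] at hm
  obtain ⟨w, jj, hj, hw, e⟩ := (S.zero' _).1 hm
  have hb := S.bpos.ne'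
  have e0 := e 0
  have e1 := e 1
  rw [Tm_zero'] at e0
  rw [Tm_one'] at e1
  simp only [intV] at e0 e1
  have f0 : b * w 0 = p * k 0 := by
    rw [← e0]
    field_simp
  refine ⟨w 0, k 0, k 1 * w 0 - k 0 * w 1, S.not_dvd hj (hw 0), f0, ?_⟩
  have f1 : c * w 0 + b * w 1 = p * k 1 := by
    rw [← e1, ← e0]
    field_simp
    ring
  push_cast
  linear_combination (w 0 : ℝ) * f1 - (w 1 : ℝ) * f0

end

lemma chain {b : ℝ} {r s : ℕ} (hb : 1 < b) (hs : 0 < s) (hrs : Nat.Coprime r s) (e : b * s = r)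
    {q : ℤ} (hq : q ≠ 0) (y : ℝ) (hy : b ≤ |y|) (J : ℕ)
    (h : ∀ k, 1 ≤ k → k ≤ J + 1 → ∃ N : ℤ, |q * (b⁻¹ ^ k * y) - N| < 1 / (r + s)) :
    (r : ℝ) ^ J ≤ 2 * |(q : ℝ)| * |y| := by
  have hb0 : 0 < b := by linarith
  have hs0 : (0 : ℝ) < s := by exact_mod_cast hs
  have hr0 : (0 : ℝ) < r := by rw [← e]; positivity
  have hs1 : (1 : ℝ) ≤ s := by exact_mod_cast hs
  have hr1 : (1 : ℝ) ≤ r := by exact_mod_cast (show 0 < r by exact_mod_cast hr0)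
  have hq1 : (1 : ℝ) ≤ |(q : ℝ)| := by exact_mod_cast Int.one_le_abs hq
  choose! N hN using h
  have hstep : ∀ k, 1 ≤ k → k ≤ J → (r : ℤ) * N (k + 1) = s * N k := by
    intro k hk hkJ
    have h1 := hN k hk (by omega)
    have h2 := hN (k + 1) (by omega) (by omega)
    have hz : |(((r : ℤ) * N (k + 1) - s * N k : ℤ) : ℝ)| < 1 := by
      have he : (((r : ℤ) * N (k + 1) - s * N k : ℤ) : ℝ)
          = s * (q * (b⁻¹ ^ k * y) - N k) - r * (q * (b⁻¹ ^ (k + 1) * y) - N (k + 1)) := by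
        push_cast
        rw [← e, pow_succ]
        field_simp
        ring
      rw [he]
      calc _ ≤ |s * (q * (b⁻¹ ^ k * y) - N k)| + |r * (q * (b⁻¹ ^ (k + 1) * y) - N (k + 1))| :=
            abs_sub _ _
        _ = s * |q * (b⁻¹ ^ k * y) - N k| + r * |q * (b⁻¹ ^ (k + 1) * y) - N (k + 1)| := by
            rw [abs_mul, abs_mul, abs_of_pos hs0, abs_of_pos hr0]
        _ < s * (1 / (r + s)) + r * (1 / (r + s)) := by gcongr
        _ = 1 := by field_simp; ring
    have hz' : |(r : ℤ) * N (k + 1) - s * N k| < 1 := by exact_mod_cast hz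
    have := Int.abs_lt_one_iff.1 hz'
    linarith
  have hall : ∀ k, k ≤ J → (r : ℤ) ^ k * N (k + 1) = s ^ k * N 1 := by
    intro k
    induction k with
    | zero => intro _; simp
    | succ k ih =>
      intro hk
      have h1 := ih (by omega)
      have h2 := hstep (k + 1) (by omega) hk
      rw [pow_succ, pow_succ]
      linear_combination (r : ℤ) ^ k * h2 + (s : ℤ) * h1
  have hdvd : (r : ℤ) ^ J ∣ N 1 := by
    have h1 : (r : ℤ) ^ J ∣ s ^ J * N 1 := ⟨_, (hall J le_rfl).symm⟩
    have hc : IsCoprime ((r : ℤ) ^ J) (s ^ J) := (Nat.isCoprime_iff_coprime.2 hrs).pow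
    exact hc.dvd_of_dvd_mul_left h1
  have h1 := hN 1 le_rfl (by omega)
  rw [pow_one] at h1
  have hδ : (1 : ℝ) / (r + s) < 1 := by
    rw [div_lt_one (by positivity)]
    linarith
  have habs : |(q : ℝ) * (b⁻¹ * y)| = |(q : ℝ)| * |y| / b := by
    rw [abs_mul, abs_mul, abs_inv, abs_of_pos hb0]
    field_simp
  have hge : 1 ≤ |(q : ℝ)| * |y| / b := by
    rw [le_div_iff₀ hb0]
    nlinarith
  have hN1 : N 1 ≠ 0 := by
    intro h0
    rw [h0] at h1
    simp only [Int.cast_zero, sub_zero] at h1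
    rw [habs] at h1
    linarith
  have hle : (r : ℝ) ^ J ≤ |(N 1 : ℝ)| := by
    have := Int.le_of_dvd (abs_pos.2 hN1) ((dvd_abs _ _).2 hdvd)
    exact_mod_cast this
  have hle2 : |(N 1 : ℝ)| ≤ |(q : ℝ)| * |y| / b + 1 := by
    have := abs_sub_abs_le_abs_sub (N 1 : ℝ) (q * (b⁻¹ * y))
    rw [abs_sub_comm, habs] at this
    linarith
  have hle3 : |(q : ℝ)| * |y| / b ≤ |(q : ℝ)| * |y| := div_le_self (by positivity) hb.le
  linarith

section
variable {p : ℕ} {b c : ℝ} {a : Fin 2 → ℤ} {m F : V2 → ℂ}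

lemma Sys.F_le_T (S : Sys p b c a m F) (n : ℕ) (x : V2) : ‖F x‖ ≤ ‖F ((Tm b c ^ n) x)‖ := by
  rw [S.F_eq n x, norm_mul]
  refine mul_le_of_le_one_left (norm_nonneg _) ?_
  unfold Fn
  rw [norm_prod]
  exact Finset.prod_le_one (fun _ _ => norm_nonneg _) (fun _ _ => S.mle _)

lemma Sys.decay (S : Sys p b c a m F) {r s : ℕ} (hs : 2 ≤ s) (hrs : Nat.Coprime r s)
    (e : b * s = r) : ∃ η : ℝ, 0 ≤ η ∧ η < 1 ∧ ∃ u L0 : ℕ, 1 ≤ u ∧ 1 ≤ L0 ∧ b ≤ (s : ℝ) ^ u ∧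
      ∀ (j : ℕ) (x : V2), b ^ (L0 * (2 * u + 1) ^ j) ≤ |x 0| → ‖F x‖ ≤ η ^ j := by
  have hb := S.hb
  have hb0 := S.bpos
  have hs1 : (1 : ℝ) < s := by exact_mod_cast (show 1 < s by omega)
  have hr0 : (0 : ℝ) < r := by rw [← e]; positivity
  obtain ⟨q, hq, -, hgen⟩ := S.gen
  obtain ⟨η, hη0, hη1, hη⟩ := hgen (1 / (r + s)) (by positivity)
  obtain ⟨u, hu⟩ := pow_unbounded_of_one_lt b hs1
  obtain ⟨L0, hL0⟩ := pow_unbounded_of_one_lt (2 * |(q : ℝ)| * r * b + 1) hb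
  have hu1 : 1 ≤ u := by
    by_contra h
    have : u = 0 := by omega
    rw [this, pow_zero] at hu
    linarith
  have hL1 : 1 ≤ L0 := by
    by_contra h
    have : L0 = 0 := by omega
    rw [this, pow_zero] at hL0
    have : 0 ≤ 2 * |(q : ℝ)| * r * b := by positivity
    linarith
  refine ⟨η, hη0, hη1, u, L0, hu1, hL1, hu.le, ?_⟩
  have hstep : ∀ (L : ℕ) (E : ℝ), L0 ≤ L → 0 ≤ E → (∀ x : V2, b ^ L ≤ |x 0| → ‖F x‖ ≤ E) →
      ∀ x : V2, b ^ (L * (2 * u + 1)) ≤ |x 0| → ‖F x‖ ≤ η * E := by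
    intro L E hL hE h x hx
    obtain ⟨n, hn1, hn2⟩ := exists_nat_pow_near ((one_le_pow₀ hb.le).trans hx) hb
    have hnle : L * (2 * u + 1) ≤ n := by
      have := (pow_lt_pow_iff_right₀ hb).1 (hx.trans_lt hn2)
      omega
    obtain ⟨d, rfl⟩ := Nat.exists_eq_add_of_le hnle
    refine (S.F_le_T d x).trans ?_
    set y := (Tm b c ^ d) x with hy
    have hy0 : |y 0| = |x 0| / b ^ d := by
      rw [hy, Tm_pow_zero', abs_mul, inv_pow, abs_inv, abs_of_pos (pow_pos hb0 d)]
      field_simp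
    have hy1 : b ^ (L * (2 * u + 1)) ≤ |y 0| := by
      rw [hy0, le_div_iff₀ (by positivity), ← pow_add]
      exact hn1
    have hy2 : |y 0| ≤ b ^ (L * (2 * u + 1) + 1) := by
      rw [hy0, div_le_iff₀ (by positivity), ← pow_add]
      refine hn2.le.trans_eq ?_
      ring_nf
    by_cases hex : ∃ k, 1 ≤ k ∧ k ≤ 2 * u * L ∧ ‖m ((Tm b c ^ k) y)‖ ≤ η
    · obtain ⟨k, hk1, hk2, hk⟩ := hex
      obtain ⟨k, rfl⟩ : ∃ n, k = n + 1 := ⟨k - 1, by omega⟩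
      refine (S.F_le_T k y).trans ?_
      rw [S.Frec, norm_mul, ← Module.End.mul_apply, ← pow_succ']
      refine mul_le_mul hk (h _ ?_) (norm_nonneg _) hη0
      rw [Tm_pow_zero', abs_mul, inv_pow, abs_inv, abs_of_pos (pow_pos hb0 _)]
      rw [inv_mul_eq_div, le_div_iff₀ (by positivity), ← pow_add]
      refine (pow_le_pow_right₀ hb.le ?_).trans hy1
      nlinarith
    · exfalso
      push Not at hex
      have hL1' : 1 ≤ L := hL1.trans hL
      have hJ : 1 ≤ 2 * u * L := Nat.one_le_iff_ne_zero.2 (by positivity)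
      obtain ⟨J, hJ'⟩ : ∃ n, 2 * u * L = n + 1 := ⟨2 * u * L - 1, by omega⟩
      have hch := chain hb (by omega) hrs e hq (y 0) (by
        refine le_trans ?_ hy1
        exact le_self_pow₀ hb.le (by positivity)) J (by
        intro k hk1 hk2
        rcases hη ((Tm b c ^ k) y) with h1 | ⟨N, hN⟩
        · exact absurd h1 (not_le.2 (hex k hk1 (by omega)))
        · exact ⟨N, by rwa [Tm_pow_zero'] at hN⟩)
      have h1 : b ^ (u + 1) ≤ (r : ℝ) ^ u := by
        rw [← e, mul_pow, pow_succ]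
        gcongr
      have h2 : b ^ (L * (2 * u + 1)) * b ^ L ≤ (r : ℝ) ^ J * r := by
        rw [← pow_succ, ← hJ', ← pow_add]
        calc b ^ (L * (2 * u + 1) + L) = (b ^ (u + 1)) ^ (2 * L) := by rw [← pow_mul]; ring_nf
          _ ≤ ((r : ℝ) ^ u) ^ (2 * L) := by gcongr
          _ = _ := by rw [← pow_mul]; ring_nf
      have h3 : b ^ L0 ≤ b ^ L := pow_le_pow_right₀ hb.le hL
      have h4 : (r : ℝ) ^ J * r ≤ 2 * |(q : ℝ)| * (b ^ (L * (2 * u + 1) + 1)) * r := by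
        gcongr
        refine hch.trans ?_
        gcongr
      rw [pow_succ] at h4
      have h5 : b ^ (L * (2 * u + 1)) * b ^ L ≤ b ^ (L * (2 * u + 1)) * (2 * |(q : ℝ)| * r * b) := by
        refine (h2.trans h4).trans_eq ?_
        ring
      have h6 := le_of_mul_le_mul_left h5 (pow_pos hb0 _)
      linarith
  intro j
  induction j with
  | zero =>
    intro x _
    rw [pow_zero]
    exact S.Fle x
  | succ j ih =>
    intro x hx
    rw [pow_succ']
    refine hstep (L0 * (2 * u + 1) ^ j) (η ^ j) ?_ (by positivity) ih x ?_
    · exact Nat.le_mul_of_pos_right _ (by positivity)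
    · rwa [mul_assoc, ← pow_succ]

lemma Fam.lev_big (S : Sys p b c a m F) {r s : ℕ} (hs : 2 ≤ s) (hrs : Nat.Coprime r s)
    (e : b * s = r) {ι : Type} {l : ι → V2} (hl : Fam F l) {i j : ι} {k : ℕ} (hk1 : 1 ≤ k)
    (hk : m ((Tm b c ^ k) (l i - l j)) = 0) : (r : ℝ) ^ k ≤ s * p * |l i 0 - l j 0| := by
  have hb0 := S.bpos
  have hs0 : (0 : ℝ) < s := by exact_mod_cast (show 0 < s by omega)
  obtain ⟨w, hw, ew⟩ := S.lev_eq hk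
  obtain ⟨z, ez⟩ := hl.diff0 S i j
  rw [Pi.sub_apply] at ew
  obtain ⟨k, rfl⟩ : ∃ n, k = n + 1 := ⟨k - 1, by omega⟩
  have h1 : b ^ k * w = z := by
    apply mul_left_cancel₀ hb0.ne'
    rw [← ez, ew, pow_succ]
    ring
  have h2 : ((r : ℤ) ^ k * w) = s ^ k * z := by
    have : ((r : ℝ) ^ k * w) = s ^ k * z := by
      rw [← h1, ← e, mul_pow]
      ring
    exact_mod_cast this
  have hdvd : (s : ℤ) ^ k ∣ w := by
    have h1 : (s : ℤ) ^ k ∣ r ^ k * w := ⟨_, h2⟩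
    have hc : IsCoprime ((s : ℤ) ^ k) (r ^ k) := (Nat.isCoprime_iff_coprime.2 hrs.symm).pow
    exact hc.dvd_of_dvd_mul_left h1
  have hw0 : w ≠ 0 := by
    rintro rfl
    exact hw (dvd_zero _)
  have hle : (s : ℝ) ^ k ≤ |(w : ℝ)| := by
    have := Int.le_of_dvd (abs_pos.2 hw0) ((dvd_abs _ _).2 hdvd)
    exact_mod_cast this
  have h3 : p * |l i 0 - l j 0| = b ^ (k + 1) * |(w : ℝ)| := by
    rw [← abs_of_pos S.ppos, ← abs_mul, ew, abs_mul, abs_of_pos (pow_pos hb0 _)]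
  rw [mul_assoc, h3, ← e, mul_pow, pow_succ (s : ℝ) k]
  calc b ^ (k + 1) * ((s : ℝ) ^ k * s) ≤ b ^ (k + 1) * (|(w : ℝ)| * s) := by gcongr
    _ = _ := by ring

end

lemma step_sum {ι : Type} (f g : ι → ℝ) (A B : Set ι) (hAB : A ⊆ B) (hf0 : ∀ i, 0 ≤ f i)
    (hfg : ∀ i, f i ≤ g i) (hf : Summable f)
    (hg : ∀ s : Finset ι, (∀ i ∈ s, i ∈ B) → ∑ i ∈ s, g i ≤ 1)
    {ε : ℝ} (hε : 0 ≤ ε) (h : ∀ i ∈ B, i ∉ A → f i ≤ ε * g i) :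
    (1 - ε) * (1 - ∑' i, A.indicator f i) ≤ 1 - ∑' i, B.indicator f i := by
  classical
  have hg0 : ∀ i, 0 ≤ g i := fun i => (hf0 i).trans (hfg i)
  have hbd : ∀ s : Finset ι, ∑ i ∈ s, B.indicator g i ≤ 1 := by
    intro s
    have := hg (s.filter (· ∈ B)) (fun i hi => (Finset.mem_filter.1 hi).2)
    rw [Finset.sum_filter] at this
    simpa [Set.indicator_apply] using this
  have hsg : Summable (B.indicator g) :=
    summable_of_sum_le (fun i => Set.indicator_nonneg (fun i _ => hg0 i) i) hbd
  have hg1 : ∑' i, B.indicator g i ≤ 1 :=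
    Real.tsum_le_of_sum_le (fun i => Set.indicator_nonneg (fun i _ => hg0 i) i) hbd
  have hsA := hf.indicator A
  have hsB := hf.indicator B
  have hpt : ∀ i, B.indicator f i ≤ A.indicator f i + ε * (B.indicator g i - A.indicator f i) := by
    intro i
    by_cases hA : i ∈ A
    · have hB := hAB hA
      simp only [Set.indicator_of_mem hA, Set.indicator_of_mem hB]
      nlinarith [hfg i]
    · by_cases hB : i ∈ B
      · simp only [Set.indicator_of_notMem hA, Set.indicator_of_mem hB]
        have := h i hB hA
        linarith
      · simp only [Set.indicator_of_notMem hA, Set.indicator_of_notMem hB]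
        simp
  have hle := hsB.tsum_le_tsum hpt (hsA.add ((hsg.sub hsA).mul_left ε))
  rw [hsA.tsum_add ((hsg.sub hsA).mul_left ε), tsum_mul_left, hsg.tsum_sub hsA] at hle
  nlinarith

lemma finish_real (D : ℕ → ℝ) (hpos : ∀ n, 0 < D n)
    (hlim : ∀ ε > 0, ∃ N, ∀ n ≥ N, D n < ε) {η : ℝ} (hη0 : 0 ≤ η) (hη1 : η < 1) {u L0 : ℕ}
    (hu : 1 ≤ u) (hL0 : 1 ≤ L0) (j0 : ℕ)
    (h : ∀ j ≥ j0, ∀ n, 2 * u * (2 * L0 * (2 * u + 1) ^ j) ≤ n →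
      (1 - η ^ j) * D n ≤ D (n + 2 * L0 * (2 * u + 1) ^ j)) : False := by
  let t : ℕ → ℕ := fun j => 2 * L0 * (2 * u + 1) ^ j
  let N : ℕ → ℕ := fun j => 2 * u * t j
  let B : ℕ := 4 * u ^ 2
  have hNs : ∀ j, N (j + 1) = N j + B * t j := by
    intro j
    simp only [N, t, B]
    ring
  have hη1j : ∀ j, η ^ j ≤ 1 := fun j => pow_le_one₀ hη0 hη1.le
  have h1 : ∀ j ≥ j0, (1 - B * η ^ j) * D (N j) ≤ D (N (j + 1)) := by
    intro j hj
    have hi : ∀ i : ℕ, (1 - η ^ j) ^ i * D (N j) ≤ D (N j + i * t j) := by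
      intro i
      induction i with
      | zero => simp
      | succ i ih =>
        have h2 := h j hj (N j + i * t j) (Nat.le_add_right _ _)
        have h3 : 0 ≤ 1 - η ^ j := by linarith [hη1j j]
        calc (1 - η ^ j) ^ (i + 1) * D (N j) = (1 - η ^ j) * ((1 - η ^ j) ^ i * D (N j)) := by ring
          _ ≤ (1 - η ^ j) * D (N j + i * t j) := by gcongr
          _ ≤ _ := h2
          _ = _ := by congr 1; simp only [t]; ring
    have h4 := hi B
    rw [← hNs] at h4
    refine le_trans ?_ h4
    have h5 := one_add_mul_le_pow (a := -η ^ j) (by linarith [hη1j j]) B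
    refine mul_le_mul_of_nonneg_right ?_ (hpos _).le
    rw [sub_eq_add_neg 1 (η ^ j)]
    linarith
  have h1η : 0 < 1 - η := by linarith
  let K : ℝ := B / (1 - η)
  have hK : K * (1 - η) = B := by simp only [K]; field_simp
  have hK0 : 0 ≤ K := by positivity
  obtain ⟨j1, hj1, hj2⟩ : ∃ j1 ≥ j0, K * η ^ j1 ≤ 1 / 2 := by
    have ht : Filter.Tendsto (fun j => K * η ^ j) Filter.atTop (nhds (K * 0)) :=
      (tendsto_pow_atTop_nhds_zero_of_lt_one hη0 hη1).const_mul K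
    rw [mul_zero] at ht
    obtain ⟨j1, h1, h2⟩ := ((ht.eventually (ge_mem_nhds (by norm_num : (0 : ℝ) < 1 / 2))).and
      (Filter.eventually_ge_atTop j0)).exists
    exact ⟨j1, h2, h1⟩
  have hmono : ∀ i, K * η ^ (j1 + i) ≤ K * η ^ j1 := by
    intro i
    exact mul_le_mul_of_nonneg_left (pow_le_pow_of_le_one hη0 hη1.le (by omega)) hK0
  have hind : ∀ i, (1 - K * η ^ j1 + K * η ^ (j1 + i)) * D (N j1) ≤ D (N (j1 + i)) := by
    intro i
    induction i with
    | zero => simp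
    | succ i ih =>
      have h2 := h1 (j1 + i) (by omega)
      have h3 : (B : ℝ) * η ^ (j1 + i) = K * η ^ (j1 + i) - K * η ^ (j1 + (i + 1)) := by
        rw [← hK, ← add_assoc, pow_succ]
        ring
      have h4 : 0 ≤ K * η ^ (j1 + (i + 1)) := by positivity
      have h5 : 0 ≤ (B : ℝ) * η ^ (j1 + i) := by positivity
      have h6 := hmono i
      have h7 : 0 ≤ 1 - (B : ℝ) * η ^ (j1 + i) := by linarith
      have h8 := mul_le_mul_of_nonneg_left ih h7
      refine le_trans ?_ (h8.trans h2)
      rw [← mul_assoc]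
      refine mul_le_mul_of_nonneg_right ?_ (hpos _).le
      nlinarith
  obtain ⟨M, hM⟩ := hlim (D (N j1) / 2) (by linarith [hpos (N j1)])
  have hNM : M ≤ N (j1 + M) := by
    have h2 : j1 + M < (2 * u + 1) ^ (j1 + M) := Nat.lt_pow_self (by omega)
    have h3 : (2 * u + 1) ^ (j1 + M) ≤ N (j1 + M) := by
      simp only [N, t]
      rw [← mul_assoc]
      refine Nat.le_mul_of_pos_left _ (by positivity)
    omega
  have h2 := hM _ hNM
  have h3 := hind M
  have h4 : 0 ≤ K * η ^ (j1 + M) := by positivity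
  have := hpos (N j1)
  nlinarith

section
variable {p : ℕ} {b c : ℝ} {a : Fin 2 → ℤ} {m F : V2 → ℂ}

lemma Fam.no_frac (S : Sys p b c a m F) {r s : ℕ} (hs : 2 ≤ s) (hrs : Nat.Coprime r s)
    (e : b * s = r) {ι : Type} {l : ι → V2} (hl : Fam F l) : False := by
  have hb := S.hb
  have hb0 := S.bpos
  have hs1 : (1 : ℝ) < s := by exact_mod_cast (show 1 < s by omega)
  have hs0 : (0 : ℝ) < s := by linarith
  have hp0 := S.ppos
  have hr1 : (1 : ℝ) < r := by rw [← e]; nlinarith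
  obtain ⟨η, hη0, hη1, u, L0, hu1, hL1, hu, hdec⟩ := S.decay hs hrs e
  have hcnt := hl.cnt
  obtain ⟨Z, hZ, hpar⟩ := hl.par
  obtain ⟨Zg, hZg, hgen⟩ := S.generic
  obtain ⟨ξ, hξ, hξi⟩ := exists_generic l hZ hZg
  have hsum := hpar ξ hξ
  set f : ι → ℝ := fun i => ‖F (ξ + l i)‖ ^ 2 with hf
  have hf0 : ∀ i, 0 < f i := fun i => by
    have := norm_pos_iff.2 (hgen _ (hξi i)).1
    positivity
  let A : ℕ → Set ι := fun n => {i | 2 * s * p * |l i 0| < (r : ℝ) ^ (n + 1)}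
  have hAmono : ∀ n n', n ≤ n' → A n ⊆ A n' := by
    intro n n' h i hi
    exact lt_of_lt_of_le hi (pow_le_pow_right₀ hr1.le (by omega))
  have hlev : ∀ n i j, i ∈ A n → j ∈ A n → ∀ k, 1 ≤ k → m ((Tm b c ^ k) (l i - l j)) = 0 →
      k ≤ n := by
    intro n i j hi hj k hk1 hk
    have h1 := hl.lev_big S hs hrs e hk1 hk
    have h2 : s * p * |l i 0 - l j 0| ≤ s * p * (|l i 0| + |l j 0|) := by
      gcongr
      exact abs_sub _ _
    have h3 : 2 * s * p * |l i 0| < (r : ℝ) ^ (n + 1) := hi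
    have h4 : 2 * s * p * |l j 0| < (r : ℝ) ^ (n + 1) := hj
    have h5 : (r : ℝ) ^ k < (r : ℝ) ^ (n + 1) := by linarith
    have := (pow_lt_pow_iff_right₀ hr1).1 h5
    omega
  obtain ⟨j0, hj0⟩ := pow_unbounded_of_one_lt (2 * s * p * (1 + |ξ 0|)) hb
  refine finish_real (fun n => 1 - ∑' i, (A n).indicator f i) ?_ ?_ hη0 hη1 hu1 hL1 j0 ?_
  · intro n
    obtain ⟨i, j, hij, hk⟩ := hl.levels_unbdd S n
    obtain ⟨k, hk1, hk0⟩ := (S.F_zero _).1 (hl.orth _ _ hij)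
    have hex : ∃ i, i ∉ A n := by
      by_contra hcon
      push Not at hcon
      exact hk k hk1 (hlev n i j (hcon i) (hcon j) k hk1 hk0) hk0
    obtain ⟨i, hi⟩ := hex
    have hlt := Summable.tsum_lt_tsum (f := (A n).indicator f) (g := f) (i := i)
      (fun x => Set.indicator_le_self' (fun x _ => (hf0 x).le) x)
      (by rw [Set.indicator_of_notMem hi]; exact hf0 i) (hsum.summable.indicator _) hsum.summable
    rw [hsum.tsum_eq] at hlt
    linarith
  · intro ε hε
    obtain ⟨T, hT⟩ := (hsum.eventually (lt_mem_nhds (show 1 - ε < 1 by linarith))).exists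
    have hex : ∀ i, ∃ n, i ∈ A n := by
      intro i
      obtain ⟨n, hn⟩ := pow_unbounded_of_one_lt (2 * s * p * |l i 0|) hr1
      exact ⟨n, hn.trans_le (pow_le_pow_right₀ hr1.le (by omega))⟩
    choose nn hnn using hex
    refine ⟨T.sup nn, fun n hn => ?_⟩
    have h1 : ∑ i ∈ T, f i = ∑ i ∈ T, (A n).indicator f i := by
      refine Finset.sum_congr rfl (fun i hi => ?_)
      rw [Set.indicator_of_mem]
      exact hAmono _ _ ((Finset.le_sup hi).trans hn) (hnn i)
    have h2 := (hsum.summable.indicator (A n)).sum_le_tsum T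
      (fun i _ => Set.indicator_nonneg (fun x _ => (hf0 x).le) i)
    linarith
  · intro j hj n hn
    set t := L0 * (2 * u + 1) ^ j with ht
    have ht2 : 2 * L0 * (2 * u + 1) ^ j = 2 * t := by rw [ht]; ring
    rw [ht2] at hn ⊢
    have hbt : 2 * s * p * (1 + |ξ 0|) ≤ b ^ t := by
      refine hj0.le.trans (pow_le_pow_right₀ hb.le (hj.trans ?_))
      have h2 : j < (2 * u + 1) ^ j := Nat.lt_pow_self (by omega)
      exact h2.le.trans (Nat.le_mul_of_pos_left _ hL1)
    have hbig : ∀ i, i ∉ A n → ‖F ((Tm b c ^ (n + 2 * t)) (ξ + l i))‖ ≤ η ^ j := by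
      intro i hi
      apply hdec j
      rw [Tm_pow_zero', abs_mul, inv_pow, abs_inv, abs_of_pos (pow_pos hb0 _),
        inv_mul_eq_div, le_div_iff₀ (pow_pos hb0 _), Pi.add_apply]
      have hi' : (r : ℝ) ^ (n + 1) ≤ 2 * s * p * |l i 0| := not_lt.1 hi
      have h1 : (r : ℝ) ^ n ≤ (r : ℝ) ^ (n + 1) := pow_le_pow_right₀ hr1.le (by omega)
      have h2 : b ^ (4 * t) ≤ (s : ℝ) ^ n := by
        calc b ^ (4 * t) ≤ ((s : ℝ) ^ u) ^ (4 * t) := by gcongr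
          _ = (s : ℝ) ^ (2 * u * (2 * t)) := by rw [← pow_mul]; ring_nf
          _ ≤ _ := pow_le_pow_right₀ hs1.le hn
      have h3 : b ^ n * b ^ (4 * t) ≤ (r : ℝ) ^ n := by
        rw [← e, mul_pow]
        gcongr
      have h4 : |l i 0| ≤ |ξ 0 + l i 0| + |ξ 0| := by
        have := abs_sub (ξ 0 + l i 0) (ξ 0)
        rwa [add_sub_cancel_left] at this
      have hX : b ^ (4 * t) = b ^ t * (b ^ t * b ^ (2 * t)) := by
        rw [← pow_add, ← pow_add]
        ring_nf
      have hY : b ^ (n + 2 * t) = b ^ n * b ^ (2 * t) := pow_add _ _ _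
      have hW : 1 ≤ b ^ t * (b ^ n * b ^ (2 * t)) := by
        rw [← pow_add, ← pow_add]
        exact one_le_pow₀ hb.le
      have h5 : 2 * s * p * (1 + |ξ 0|) * (b ^ t * (b ^ n * b ^ (2 * t)))
          ≤ 2 * s * p * |l i 0| := by
        calc _ ≤ b ^ t * (b ^ t * (b ^ n * b ^ (2 * t))) := by gcongr
          _ = b ^ n * b ^ (4 * t) := by rw [hX]; ring
          _ ≤ _ := h3.trans (h1.trans hi')
      rw [mul_assoc] at h5
      have h6 := le_of_mul_le_mul_left h5 (by positivity)
      rw [hY]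
      change b ^ t * (b ^ n * b ^ (2 * t)) ≤ _
      nlinarith [abs_nonneg (ξ 0)]
    refine step_sum f (fun i => ‖Fn b c m (n + 2 * t) (ξ + l i)‖ ^ 2) (A n) (A (n + 2 * t))
      (hAmono _ _ (by omega)) (fun i => (hf0 i).le) ?_ hsum.summable ?_ (by positivity) ?_
    · intro i
      simp only [hf]
      rw [S.F_eq (n + 2 * t), norm_mul]
      gcongr
      exact mul_le_of_le_one_right (norm_nonneg _) (S.Fle _)
    · intro T hT
      refine (S.Fn_FT (n + 2 * t)).bessel l T (fun i hi k hk hik => ?_) ξ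
      rw [Sys.Fn_zero]
      obtain ⟨v, hv1, hv0⟩ := (S.F_zero _).1 (hl.orth _ _ hik)
      exact ⟨v, hv1, hlev _ i k (hT i hi) (hT k hk) v hv1 hv0, hv0⟩
    · intro i _ hi
      simp only [hf]
      rw [S.F_eq (n + 2 * t), norm_mul, mul_pow, mul_comm]
      gcongr
      have h1 := hbig i hi
      have h2 : η ^ j ≤ 1 := pow_le_one₀ hη0 hη1.le
      nlinarith [norm_nonneg (F ((Tm b c ^ (n + 2 * t)) (ξ + l i)))]

end

lemma Fam.necessity {p : ℕ} {b c : ℝ} {a : Fin 2 → ℤ} {m F : V2 → ℂ} (S : Sys p b c a m F)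
    {ι : Type} {l : ι → V2} (hl : Fam F l) :
    (∃ n : ℤ, (p : ℤ) ∣ n ∧ b = (n : ℝ)) ∧
      ∃ t s : ℤ, (p : ℤ) ∣ t ∧ Int.gcd t s = 1 ∧ c = (t : ℝ) / (s : ℝ) := by
  obtain ⟨w0, k0, d, hw, hb, hc⟩ := hl.rat S
  have hw0 : w0 ≠ 0 := by
    rintro rfl
    exact hw (dvd_zero _)
  have hwR : (w0 : ℝ) ≠ 0 := by exact_mod_cast hw0
  constructor
  · let q : ℚ := p * k0 / w0
    have hbq : b = (q : ℝ) := by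
      simp only [q]
      push_cast
      rw [← hb]
      field_simp
    have hq0 : 0 < q := by
      have := S.bpos
      rw [hbq] at this
      exact_mod_cast this
    have hden : (q.den : ℝ) ≠ 0 := by exact_mod_cast q.den_nz
    obtain ⟨R, hR⟩ : ∃ R : ℕ, q.num = R := ⟨q.num.natAbs, by
      rw [Int.natAbs_of_nonneg (Rat.num_pos.2 hq0).le]⟩
    have e : b * q.den = (R : ℝ) := by
      have h3 : (R : ℚ) = (q.num : ℚ) := by rw [hR]; simp
      have h4 : q * q.den = R := by rw [h3]; exact Rat.mul_den_eq_num q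
      rw [hbq]
      exact_mod_cast h4
    have hred : Nat.Coprime R q.den := by
      have := q.reduced
      rwa [hR, Int.natAbs_natCast] at this
    have hs1 : q.den = 1 := by
      by_contra hne
      have hden2 : 2 ≤ q.den := by
        have := q.den_nz
        omega
      exact hl.no_frac S hden2 hred e
    rw [hs1, Nat.cast_one, mul_one] at e
    refine ⟨(R : ℤ), ?_, by rw [e]; simp⟩
    have h1 : (p : ℤ) ∣ (R : ℤ) * w0 := by
      refine ⟨k0, ?_⟩
      have : (R : ℝ) * w0 = p * k0 := by rw [← e, hb]
      exact_mod_cast this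
    exact (S.pint.dvd_or_dvd h1).resolve_right hw
  · let q : ℚ := p * d / w0 ^ 2
    have hcq : c = (q : ℝ) := by
      simp only [q]
      push_cast
      rw [← hc]
      field_simp
    refine ⟨q.num, q.den, ?_, ?_, ?_⟩
    · have h1 : (p : ℤ) ∣ q.num * w0 ^ 2 := by
        refine ⟨d * q.den, ?_⟩
        have h2 : (q.num : ℝ) = c * q.den := by
          rw [hcq]
          exact_mod_cast (Rat.mul_den_eq_num q).symm
        have : (q.num : ℝ) * w0 ^ 2 = p * (d * q.den) := by
          rw [h2]
          linear_combination (q.den : ℝ) * hc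
        exact_mod_cast this
      exact (S.pint.dvd_or_dvd h1).resolve_right (fun h => hw (S.pint.dvd_of_dvd_pow h))
    · have := q.reduced
      rw [Int.gcd, Int.natAbs_natCast]
      exact this
    · rw [hcq]
      exact_mod_cast (Rat.num_div_den q).symm

/-- Theorem 1.3: with `ρ₁ = ρ₂ = ρ`, `μ_{M,D}` is a spectral measure iff `ρ⁻¹ ∈ pℤ` and
`c ∈ {t/s : t ∈ pℤ, gcd(t,s)=1} ∪ {0}`. -/
theorem stmt4 (p : ℕ) (hp : p.Prime) (ρ c : ℝ) (hρ0 : 0 < ρ) (hρ1 : ρ < 1)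
    (D : Fin p → (Fin 2 → ℤ)) (hD : Function.Injective D)
    (a : Fin 2 → ℤ) (hZ : ZeroSetCond p D a)
    (μ : Measure (Fin 2 → ℝ)) (hμ : IsSelfAffine μ (Mupper ρ ρ c) (digitR D)) :
    IsSpectral μ ↔
      ((∃ n : ℤ, (p : ℤ) ∣ n ∧ ρ⁻¹ = (n : ℝ)) ∧
        (c = 0 ∨ ∃ t s : ℤ, (p : ℤ) ∣ t ∧ Int.gcd t s = 1 ∧ c = (t : ℝ) / (s : ℝ))) := by
  have S := sys_mk hp hρ0 hρ1 D hD a hZ μ hμ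
  have hprob : IsProbabilityMeasure μ := hμ.1
  constructor
  · intro h
    obtain ⟨Λ, hΛ, horth, hpar⟩ := spectral_parseval μ h
    have hl : Fam (ftMeasure μ) (fun i : Λ => (i : V2)) :=
      ⟨hΛ.to_subtype, horth, ∅, Set.countable_empty, fun ξ _ => hpar ξ⟩
    obtain ⟨h1, h2⟩ := hl.necessity S
    exact ⟨h1, Or.inr h2⟩
  · rintro ⟨⟨n, hn, hbn⟩, hc⟩
    have key : ∃ t s : ℤ, ¬ (p : ℤ) ∣ s ∧ (p : ℤ) ∣ t ∧ c * s = t := by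
      rcases hc with rfl | ⟨t, s, ht, hg, rfl⟩
      · refine ⟨0, 1, ?_, dvd_zero _, by simp⟩
        intro h
        exact S.pint.not_isUnit (isUnit_of_dvd_one h)
      · have hs : ¬ (p : ℤ) ∣ s := by
          intro h
          have := Int.dvd_coe_gcd ht h
          rw [hg] at this
          exact S.pint.not_isUnit (isUnit_of_dvd_one (by simpa using this))
        refine ⟨t, s, hs, ht, ?_⟩
        have : (s : ℝ) ≠ 0 := by
          intro h
          apply hs
          rw [show s = 0 by exact_mod_cast h]
          exact dvd_zero _
        field_simp
    obtain ⟨t, s, hs, ht, hcs⟩ := key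
    obtain ⟨l, hl⟩ := S.suff hn hbn hs ht hcs
    exact parseval_spectral μ l hl

end
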